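/- arXiv:2301.00441 — 2 statements merged into one kernel-verified Lean document; each statement's English description precedes it below -/
import Mathlib

section
/- There exists an absolute constant C > 0 with the following property. Let g : ℝ → ℝ be a monotonically increasing positive function with g(x) → ∞ as x → ∞, and for a positive integer Q let S(g,Q) be the set of reduced fractions a/b with integers a ≥ 1, b ≥ 1, gcd(a,b) = 1, b ≤ Q, and a/b ≤ 1/g(Q). Then for all integers Q ≥ 2 with g(Q) ≥ 1, | Σ_{a/b ∈ S(g,Q)} s(b,a) | ≤ C·(Q²/g(Q)²)·(log Q)². -/
open Classical in
/-- The sawtooth function `((x))`: `x - ⌊x⌋ - 1/2` for non-integral `x`, and `0` on `ℤ`. -/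
noncomputable def saw (x : ℝ) : ℝ := if Int.fract x = 0 then 0 else Int.fract x - 1/2

/-- The Dedekind sum `s(a,b) = ∑_{n=1}^{b} ((n/b))·((na/b))`. -/
noncomputable def dedekindSum (a b : ℤ) : ℝ :=
  ∑ n ∈ Finset.Icc 1 b.toNat, saw ((n : ℝ) / (b : ℝ)) * saw ((n : ℝ) * (a : ℝ) / (b : ℝ))

/-- The Dedekind sum of a rational number `x = a/b` (in lowest terms), `s(x) = s(a,b)`. -/
noncomputable def sQ (x : ℚ) : ℝ := dedekindSum x.num x.den


lemma saw_add_int (x : ℝ) (n : ℤ) : saw (x + n) = saw x := by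
  unfold saw; rw [Int.fract_add_intCast]

lemma saw_zero : saw 0 = 0 := by simp [saw]

lemma saw_mem {x : ℝ} (h0 : 0 < x) (h1 : x < 1) : saw x = x - 1/2 := by
  unfold saw
  rw [Int.fract_eq_self.2 ⟨h0.le, h1⟩, if_neg h0.ne']

lemma saw_neg (x : ℝ) : saw (-x) = - saw x := by
  unfold saw
  by_cases h : Int.fract x = 0
  · have h' : Int.fract (-x) = 0 := Int.fract_neg_eq_zero.2 h
    rw [if_pos h, if_pos h']; simp
  · have h' : ¬ Int.fract (-x) = 0 := fun hh => h (Int.fract_neg_eq_zero.1 hh)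
    rw [if_neg h, if_neg h', Int.fract_neg h]; ring

noncomputable def FF (a : ℕ) (j : ZMod a) : ℝ := saw ((j.val : ℝ) / a)

lemma FF_int (a : ℕ) [NeZero a] (i : ℤ) : FF a (i : ZMod a) = saw ((i : ℝ) / a) := by
  have ha : (a : ℝ) ≠ 0 := Nat.cast_ne_zero.2 (NeZero.ne a)
  unfold FF
  have h := ZMod.val_intCast (n := a) i
  have h2 : ((((i : ZMod a).val : ℤ)) : ℝ) = ((i % (a : ℤ) : ℤ) : ℝ) := by rw [h]
  have h3 : (i : ℝ) = ((i % (a : ℤ) : ℤ) : ℝ) + (a : ℝ) * ((i / (a : ℤ) : ℤ) : ℝ) := by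
    exact_mod_cast (Int.emod_add_mul_ediv i a).symm
  have h4 : (i : ℝ) / a = ((i : ZMod a).val : ℝ) / a + ((i / (a : ℤ) : ℤ) : ℝ) := by
    rw [h3, ← h2]; push_cast; field_simp
  rw [h4, saw_add_int]

lemma FF_neg (a : ℕ) [NeZero a] (j : ZMod a) : FF a (-j) = - FF a j := by
  have h : j = ((j.val : ℤ) : ZMod a) := by simp
  have h' : -j = ((-(j.val : ℤ) : ℤ) : ZMod a) := by simp
  rw [h', FF_int]
  unfold FF
  rw [← saw_neg]; push_cast; congr 1; ring

lemma FF_diff (a : ℕ) [NeZero a] (j : ZMod a) :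
    FF a j - FF a (j - 1) = 1 / a - (if j = 0 then 1/2 else 0) - (if j = 1 then 1/2 else 0) := by
  have ha : 0 < a := Nat.pos_of_ne_zero (NeZero.ne a)
  have haR : (0:ℝ) < a := by exact_mod_cast ha
  have hlt := ZMod.val_lt j
  set v := j.val with hv
  have hj : j = ((v : ℤ) : ZMod a) := by simp [hv]
  have hj1 : j - 1 = (((v : ℤ) - 1 : ℤ) : ZMod a) := by simp [hv]
  rw [hj1, hj, FF_int, FF_int]
  rcases Nat.lt_or_ge a 2 with h2 | h2
  · have : a = 1 := by omega
    subst this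
    have : v = 0 := by omega
    rw [this]
    have : saw (-1) = 0 := by
      have := saw_add_int 0 (-1)
      rw [saw_zero] at this; simpa using this
    simp [saw_zero, this, Subsingleton.elim (0 : ZMod 1) 1]; norm_num
  have h01 : ((v:ℤ) : ZMod a) = 0 ↔ v = 0 := by
    rw [← hj, hv, ZMod.val_eq_zero]
  have h11 : ((v:ℤ) : ZMod a) = 1 ↔ v = 1 := by
    rw [← hj, hv]
    haveI : Fact (1 < a) := ⟨h2⟩
    constructor
    · rintro h; rw [h, ZMod.val_one]
    · intro h; exact ZMod.val_injective a (by rw [h, ZMod.val_one])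
  simp only [h01, h11]
  have h2R : (2:ℝ) ≤ a := by exact_mod_cast h2
  have hltR : (v:ℝ) < a := by exact_mod_cast hlt
  have hi1 : (1:ℝ)/a < 1 := by rw [div_lt_one haR]; linarith
  rcases Nat.lt_or_ge v 2 with hv2 | hv2
  · interval_cases v
    · have : saw (1/(a:ℝ)) = 1/a - 1/2 := saw_mem (by positivity) hi1
      have e : (((0:ℕ):ℤ) - 1 : ℤ) / (a:ℝ) = -(1/(a:ℝ)) := by push_cast; ring
      rw [e, saw_neg, this]; simp [saw_zero]
    · have : saw (1/(a:ℝ)) = 1/a - 1/2 := saw_mem (by positivity) hi1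
      simp [saw_zero]; rw [← one_div, this]; ring
  · have hv2R : (2:ℝ) ≤ v := by exact_mod_cast hv2
    rw [if_neg (by omega), if_neg (by omega)]
    rw [saw_mem, saw_mem]
    · push_cast; ring
    · push_cast; apply div_pos _ haR; linarith
    · push_cast; rw [div_lt_one haR]; linarith
    · push_cast; apply div_pos _ haR; linarith
    · push_cast; rw [div_lt_one haR]; linarith

lemma sum_Ico_zmod (a : ℕ) [NeZero a] (h : ZMod a → ℝ) (m : ℕ) :
    ∑ b ∈ Finset.Ico m (m + a), h b = ∑ x, h x := by
  have ha : 0 < a := Nat.pos_of_ne_zero (NeZero.ne a)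
  induction m with
  | zero =>
    rw [zero_add, ← Finset.range_eq_Ico]
    refine Finset.sum_bij' (fun b _ => (b : ZMod a)) (fun x _ => x.val) ?_ ?_ ?_ ?_ ?_
    · intros; simp
    · intro x _; simpa using ZMod.val_lt x
    · intro b hb; exact ZMod.val_cast_of_lt (by simpa using hb)
    · intro x _; simp
    · intros; rfl
  | succ m ih =>
    rw [← ih]
    have h1 := Finset.sum_Ico_succ_top (show m + 1 ≤ m + a by omega) (fun b : ℕ => h b)
    have h2 := Finset.sum_eq_sum_Ico_succ_bot (show m < m + a by omega) (fun b : ℕ => h b)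
    rw [show m + 1 + a = m + a + 1 by ring, h1, h2]
    simp [add_comm]

lemma sum_range_mul_zmod (a : ℕ) [NeZero a] (h : ZMod a → ℝ) (d : ℕ) :
    ∑ b ∈ Finset.range (d * a), h b = d * ∑ x, h x := by
  induction d with
  | zero => simp
  | succ d ih =>
    rw [add_mul, one_mul, Finset.range_eq_Ico,
      ← Finset.sum_Ico_consecutive _ (Nat.zero_le (d*a)) (Nat.le_add_right _ _),
      ← Finset.range_eq_Ico, ih, sum_Ico_zmod]
    push_cast; ring

lemma sum_incomplete (a : ℕ) [NeZero a] (h : ZMod a → ℝ) (h0 : ∑ x, h x = 0) (L : ℕ) :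
    ∀ m, |∑ b ∈ Finset.Ico m (m + L), h b| ≤ ∑ x, |h x| := by
  have ha : 0 < a := Nat.pos_of_ne_zero (NeZero.ne a)
  induction L using Nat.strong_induction_on with
  | _ L ih =>
    intro m
    rcases Nat.lt_or_ge L a with hL | hL
    · rw [← sum_Ico_zmod a (fun x => |h x|) m]
      refine (Finset.abs_sum_le_sum_abs _ _).trans ?_
      apply Finset.sum_le_sum_of_subset_of_nonneg
      · exact Finset.Ico_subset_Ico le_rfl (by omega)
      · intros; positivity
    · rw [← Finset.sum_Ico_consecutive _ (Nat.le_add_right m a) (by omega : m + a ≤ m + L),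
        sum_Ico_zmod, h0, zero_add]
      have := ih (L - a) (by omega) (m + a)
      rwa [show m + a + (L - a) = m + L by omega] at this

noncomputable def phiW (a : ℕ) [NeZero a] (k : ZMod a) : ℝ := ‖1 - ZMod.stdAddChar k‖⁻¹

noncomputable def Fh (a : ℕ) [NeZero a] (k : ZMod a) : ℂ :=
  ∑ j : ZMod a, ZMod.stdAddChar (-(j * k)) * (FF a j : ℂ)

lemma Fh_inv (a : ℕ) [NeZero a] (m : ZMod a) :
    (FF a m : ℂ) = (a : ℂ)⁻¹ * ∑ k : ZMod a, ZMod.stdAddChar (k * m) * Fh a k := by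
  have h := ZMod.invDFT_apply (ZMod.dft (fun j : ZMod a => (FF a j : ℂ))) m
  rw [LinearEquiv.symm_apply_apply] at h
  rw [h]
  simp only [ZMod.dft_apply, smul_eq_mul, Fh]

lemma FF_sum (a : ℕ) [NeZero a] : ∑ j, FF a j = 0 := by
  have h := Equiv.sum_comp (Equiv.neg (ZMod a)) (FF a)
  simp only [Equiv.neg_apply, FF_neg, Finset.sum_neg_distrib] at h
  linarith

lemma norm_std (a : ℕ) [NeZero a] (k : ZMod a) : ‖ZMod.stdAddChar k‖ = 1 := by
  rw [ZMod.stdAddChar_apply]; exact Circle.norm_coe _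

lemma Fh_bound (a : ℕ) [NeZero a] (k : ZMod a) : ‖Fh a (-k)‖ ≤ phiW a k := by
  by_cases hk : k = 0
  · subst hk
    have : Fh a (-0) = 0 := by
      simp only [Fh, neg_zero, mul_zero, AddChar.map_zero_eq_one, one_mul]
      exact_mod_cast FF_sum a
    rw [this]; simp [phiW]
  have hne : 1 - ZMod.stdAddChar k ≠ 0 := by
    intro h
    apply hk
    apply ZMod.injective_stdAddChar
    rw [AddChar.map_zero_eq_one]
    exact (sub_eq_zero.1 h).symm
  have key : (1 - ZMod.stdAddChar k) * Fh a (-k) = - (1/2) - (1/2) * ZMod.stdAddChar k := by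
    have hs : ZMod.stdAddChar k * Fh a (-k)
        = ∑ j : ZMod a, ZMod.stdAddChar (-(j * (-k))) * (FF a (j - 1) : ℂ) := by
      unfold Fh
      rw [Finset.mul_sum, ← Equiv.sum_comp (Equiv.addRight (1 : ZMod a))
        (fun j : ZMod a => ZMod.stdAddChar (-(j * (-k))) * (FF a (j - 1) : ℂ))]
      refine Finset.sum_congr rfl fun j _ => ?_
      simp only [Equiv.coe_addRight, add_sub_cancel_right]
      rw [← mul_assoc, ← AddChar.map_add_eq_mul]
      congr 2; ring
    have hd : ∀ j : ZMod a, (FF a j : ℂ) - (FF a (j - 1) : ℂ) =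
        1 / a - (if j = 0 then 1/2 else 0) - (if j = 1 then 1/2 else 0) := by
      intro j
      have := FF_diff a j
      have h2 : ((FF a j - FF a (j - 1) : ℝ) : ℂ) = ((1 / a - (if j = 0 then 1/2 else 0) - (if j = 1 then 1/2 else 0) : ℝ) : ℂ) := by rw [this]
      push_cast at h2
      rw [h2]; split_ifs <;> push_cast <;> ring
    have hz : ∑ j : ZMod a, ZMod.stdAddChar (j * k) = 0 := by
      have := AddChar.sum_mulShift k (ZMod.isPrimitive_stdAddChar a)
      rw [if_neg hk] at this; simpa using this
    rw [sub_mul, hs, one_mul]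
    unfold Fh
    rw [← Finset.sum_sub_distrib]
    simp only [← mul_sub, hd]
    simp only [mul_sub, Finset.sum_sub_distrib, mul_neg, neg_neg, ← Finset.sum_mul, hz, mul_ite, mul_zero,
      Finset.sum_ite_eq', Finset.mem_univ, if_true, zero_mul, one_mul, AddChar.map_zero_eq_one]
    ring
  unfold phiW
  rw [← one_div, le_div_iff₀ (norm_pos_iff.2 hne), mul_comm, ← norm_mul, key]
  refine (norm_sub_le _ _).trans ?_
  rw [norm_mul, norm_std]; norm_num

noncomputable def SS (a : ℕ) [NeZero a] (b : ZMod a) : ℝ := ∑ n, FF a n * FF a (n * b)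

lemma SS_neg (a : ℕ) [NeZero a] (b : ZMod a) : SS a (-b) = - SS a b := by
  unfold SS
  rw [← Finset.sum_neg_distrib]
  refine Finset.sum_congr rfl fun n _ => ?_
  rw [mul_neg, FF_neg]; ring

lemma SS_bound (a : ℕ) [NeZero a] (b : ZMod a) :
    |SS a b| ≤ (a : ℝ)⁻¹ * ∑ k : ZMod a, phiW a (-k) * phiW a (k * b) := by
  have h : (SS a b : ℂ) = (a : ℂ)⁻¹ * ∑ k : ZMod a, Fh a k * Fh a (-(k * b)) := by
    unfold SS
    push_cast
    simp_rw [fun n : ZMod a => Fh_inv a (n * b)]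
    simp_rw [Finset.mul_sum]
    rw [Finset.sum_comm]
    refine Finset.sum_congr rfl fun k _ => ?_
    conv_rhs => rw [Fh.eq_def a (-(k*b)), Finset.mul_sum, Finset.mul_sum]
    refine Finset.sum_congr rfl fun n _ => ?_
    rw [show -(n * -(k * b)) = k * (n * b) by ring]
    ring
  have h1 : |SS a b| = ‖(SS a b : ℂ)‖ := by simp
  rw [h1, h, norm_mul, norm_inv, Complex.norm_natCast]
  gcongr
  refine (norm_sum_le _ _).trans (Finset.sum_le_sum fun k _ => ?_)
  rw [norm_mul]
  gcongr
  · unfold phiW; positivity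
  · simpa using Fh_bound a (-k)
  · exact Fh_bound a (k*b)

lemma phi_le (a : ℕ) [NeZero a] (j : ℕ) (h0 : 0 < j) (h1 : j < a) :
    phiW a (j : ZMod a) ≤ a / 4 * ((j : ℝ)⁻¹ + ((a - j : ℕ) : ℝ)⁻¹) := by
  have haR : (0:ℝ) < a := by exact_mod_cast (h0.trans h1)
  have hjR : (0:ℝ) < j := by exact_mod_cast h0
  have hjaR : (j:ℝ) < a := by exact_mod_cast h1
  have e : ZMod.stdAddChar (j : ZMod a) = Complex.exp (Complex.I * ((2 * Real.pi * (j / a) : ℝ) : ℂ)) := by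
    have := ZMod.stdAddChar_coe (N := a) (j : ℤ)
    push_cast at this
    rw [this]; congr 1; push_cast; ring
  have hpi := Real.pi_pos
  unfold phiW
  rw [norm_sub_rev, e, Complex.norm_exp_I_mul_ofReal_sub_one, Nat.cast_sub h1.le]
  set t : ℝ := j / a with ht
  have ht0 : 0 < t := by positivity
  have ht1 : t < 1 := by rw [ht, div_lt_one haR]; exact hjaR
  have hr : a / 4 * ((j : ℝ)⁻¹ + ((a:ℝ) - j)⁻¹) = (4 * t)⁻¹ + (4 * (1 - t))⁻¹ := by
    have : (a:ℝ) - j ≠ 0 := by linarith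
    have h3 : 1 - t = (a - j) / a := by rw [ht]; field_simp
    rw [h3, ht]; field_simp
  rw [hr, show 2 * Real.pi * t / 2 = Real.pi * t by ring]
  have p1 : 0 < (4 * t)⁻¹ := by positivity
  have p2 : 0 < (4 * (1-t))⁻¹ := by have : 0 < 1 - t := by linarith
                                    positivity
  rw [Real.norm_eq_abs]
  rcases le_total t (1/2) with h | h
  · have hs := Real.mul_le_sin (x := Real.pi * t) (by positivity) (by nlinarith)
    have : 2 / Real.pi * (Real.pi * t) = 2 * t := by field_simp
    rw [this] at hs
    have : 4 * t ≤ |2 * Real.sin (Real.pi * t)| := le_trans (by linarith) (le_abs_self _)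
    have := inv_anti₀ (by positivity) this
    linarith
  · have h' : 0 < 1 - t := by linarith
    have hs := Real.mul_le_sin (x := Real.pi * (1 - t)) (by positivity) (by nlinarith)
    have : 2 / Real.pi * (Real.pi * (1 - t)) = 2 * (1 - t) := by field_simp
    rw [this, show Real.pi * (1 - t) = Real.pi - Real.pi * t by ring, Real.sin_pi_sub] at hs
    have : 4 * (1 - t) ≤ |2 * Real.sin (Real.pi * t)| := le_trans (by linarith) (le_abs_self _)
    have := inv_anti₀ (by positivity) this
    linarith

lemma phi_sum (a : ℕ) [NeZero a] : ∑ k, phiW a k ≤ a / 2 * (1 + Real.log a) := by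
  have ha : 0 < a := Nat.pos_of_ne_zero (NeZero.ne a)
  rw [← sum_Ico_zmod a (phiW a) 0, zero_add, Finset.sum_eq_sum_Ico_succ_bot ha]
  have h00 : phiW a ((0:ℕ) : ZMod a) = 0 := by simp [phiW]
  rw [h00, zero_add, zero_add]
  have h1 : ∑ k ∈ Finset.Ico 1 a, phiW a (k : ZMod a) ≤
      ∑ k ∈ Finset.Ico 1 a, a / 4 * ((k : ℝ)⁻¹ + ((a - k : ℕ) : ℝ)⁻¹) :=
    Finset.sum_le_sum fun k hk => by
      rw [Finset.mem_Ico] at hk; exact phi_le a k (by omega) hk.2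
  refine h1.trans ?_
  rw [← Finset.mul_sum, Finset.sum_add_distrib]
  have h2 : ∑ k ∈ Finset.Ico 1 a, ((a - k : ℕ) : ℝ)⁻¹ = ∑ k ∈ Finset.Ico 1 a, (k : ℝ)⁻¹ := by
    refine Finset.sum_nbij' (fun k => a - k) (fun k => a - k) ?_ ?_ ?_ ?_ ?_ <;>
      intro k hk <;> simp only [Finset.mem_Ico] at * <;> omega
  have h3 : ∑ k ∈ Finset.Ico 1 a, (k : ℝ)⁻¹ ≤ 1 + Real.log a := by
    refine le_trans ?_ (harmonic_le_one_add_log a)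
    rw [harmonic_eq_sum_Icc]
    push_cast
    apply Finset.sum_le_sum_of_subset_of_nonneg
    · intro k; simp only [Finset.mem_Ico, Finset.mem_Icc]; omega
    · intros; positivity
  rw [h2]
  have : (0:ℝ) ≤ a / 4 := by positivity
  nlinarith

lemma phi_mul_sum (a : ℕ) [NeZero a] (k : ZMod a) :
    ∑ b, phiW a (k * b) ≤ a / 2 * (1 + Real.log a) := by
  have ha : 0 < a := Nat.pos_of_ne_zero (NeZero.ne a)
  obtain ⟨k, rfl⟩ := ZMod.natCast_zmod_surjective k
  obtain ⟨d, hd⟩ : ∃ d, d = Nat.gcd k a := ⟨_, rfl⟩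
  have hd0 : 0 < d := hd ▸ Nat.gcd_pos_of_pos_right k ha
  obtain ⟨k', a', hcop, hk', ha'⟩ := Nat.exists_coprime k a
  rw [← hd] at hk' ha'
  have ha0 : a' ≠ 0 := by rintro rfl; simp at ha'; omega
  haveI : NeZero a' := ⟨ha0⟩
  have hdR : (d : ℂ) ≠ 0 := by exact_mod_cast hd0.ne'
  have haC : (a' : ℂ) ≠ 0 := by exact_mod_cast ha0
  have e : ∀ b : ℕ, phiW a ((k : ZMod a) * (b : ZMod a)) = phiW a' ((k' : ZMod a') * (b : ZMod a')) := by
    intro b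
    unfold phiW
    have h1 := ZMod.stdAddChar_coe (N := a) ((k * b : ℕ) : ℤ)
    have h2 := ZMod.stdAddChar_coe (N := a') ((k' * b : ℕ) : ℤ)
    push_cast at h1 h2
    rw [h1, h2]
    have hkC : (k : ℂ) = k' * d := by exact_mod_cast hk'
    have haaC : (a : ℂ) = a' * d := by exact_mod_cast ha'
    rw [hkC, haaC]
    congr 4
    field_simp
  rw [← sum_Ico_zmod a (fun b => phiW a ((k : ZMod a) * b)) 0, zero_add]
  simp only [e]
  have h5 := sum_range_mul_zmod a' (fun x => phiW a' ((k' : ZMod a') * x)) d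
  rw [mul_comm d a', ← ha', Finset.range_eq_Ico] at h5
  rw [h5]
  have h6 : ∑ x, phiW a' ((k' : ZMod a') * x) = ∑ x, phiW a' x := by
    have hu : IsUnit (k' : ZMod a') := (ZMod.isUnit_iff_coprime k' a').2 hcop
    exact Fintype.sum_equiv (Units.mulLeft hu.unit) _ _ (fun x => by simp)
  rw [h6]
  have h7 := phi_sum a'
  have haaR : (a : ℝ) = a' * d := by exact_mod_cast ha'
  have hl : Real.log a' ≤ Real.log a := by
    apply Real.log_le_log
    · exact_mod_cast Nat.pos_of_ne_zero ha0
    · have : a' ≤ a := by rw [ha']; exact Nat.le_mul_of_pos_right _ hd0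
      exact_mod_cast this
  calc (d:ℝ) * ∑ x, phiW a' x ≤ d * (a' / 2 * (1 + Real.log a')) := by gcongr
    _ = a / 2 * (1 + Real.log a') := by rw [haaR]; ring
    _ ≤ _ := by gcongr

lemma SS_sum (a : ℕ) [NeZero a] : ∑ b, |SS a b| ≤ a / 4 * (1 + Real.log a)^2 := by
  have ha : 0 < a := Nat.pos_of_ne_zero (NeZero.ne a)
  have haR : (0:ℝ) < a := by exact_mod_cast ha
  have hl : 0 ≤ Real.log a := Real.log_natCast_nonneg a
  calc ∑ b, |SS a b| ≤ ∑ b, (a : ℝ)⁻¹ * ∑ k : ZMod a, phiW a (-k) * phiW a (k * b) :=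
        Finset.sum_le_sum fun b _ => SS_bound a b
    _ = (a : ℝ)⁻¹ * ∑ k : ZMod a, phiW a (-k) * ∑ b, phiW a (k * b) := by
        rw [← Finset.mul_sum, Finset.sum_comm]; simp only [Finset.mul_sum]
    _ ≤ (a : ℝ)⁻¹ * ∑ k : ZMod a, phiW a (-k) * (a / 2 * (1 + Real.log a)) := by
        gcongr with k
        · unfold phiW; positivity
        · exact phi_mul_sum a k
    _ = (a : ℝ)⁻¹ * ((∑ k : ZMod a, phiW a k) * (a / 2 * (1 + Real.log a))) := by
        rw [← Finset.sum_mul]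
        congr 2
        exact Equiv.sum_comp (Equiv.neg (ZMod a)) (phiW a)
    _ ≤ (a : ℝ)⁻¹ * ((a / 2 * (1 + Real.log a)) * (a / 2 * (1 + Real.log a))) := by
        gcongr; exact phi_sum a
    _ = _ := by field_simp; ring

lemma dedekind_eq (a : ℕ) [NeZero a] (b : ℕ) : dedekindSum b a = SS a (b : ZMod a) := by
  unfold dedekindSum SS
  rw [← sum_Ico_zmod a (fun n => FF a n * FF a (n * (b : ZMod a))) 1]
  rw [Int.toNat_natCast, show Finset.Icc 1 a = Finset.Ico 1 (1 + a) by ext; simp; omega]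
  refine Finset.sum_congr rfl fun n _ => ?_
  have h1 := FF_int a (n : ℤ)
  have h2 := FF_int a ((n : ℤ) * (b : ℤ))
  push_cast at h1 h2
  rw [h1, h2]; push_cast; rfl

lemma inner_bound (a : ℕ) [NeZero a] (m n : ℕ) :
    |∑ b ∈ Finset.Ico m n, if Nat.gcd a b = 1 then dedekindSum b a else 0|
      ≤ a / 4 * (1 + Real.log a)^2 := by
  classical
  rcases Nat.le_total n m with h | h
  · rw [Finset.Ico_eq_empty_of_le h]; simp; positivity
  obtain ⟨L, rfl⟩ := Nat.exists_eq_add_of_le h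
  set f : ZMod a → ℝ := fun x => if IsUnit x then SS a x else 0 with hf
  have hz : ∑ x, f x = 0 := by
    have h := Equiv.sum_comp (Equiv.neg (ZMod a)) f
    have h2 : ∀ x, f (-x) = - f x := by
      intro x; simp only [hf, IsUnit.neg_iff, SS_neg]; split_ifs <;> simp
    simp only [Equiv.neg_apply, h2, Finset.sum_neg_distrib] at h
    linarith
  have e : ∀ b : ℕ, (if Nat.gcd a b = 1 then dedekindSum b a else 0) = f b := by
    intro b
    simp only [hf, ZMod.isUnit_iff_coprime, dedekind_eq, Nat.coprime_comm (n := b) (m := a)]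
  simp only [e]
  refine (sum_incomplete a f hz L m).trans (le_trans (Finset.sum_le_sum fun x _ => ?_) (SS_sum a))
  simp only [hf]; split_ifs <;> simp

/-- **Lemma 5.1.** For a monotonically increasing positive function `g` tending to infinity,
the sum of `s(b,a)` over the reduced fractions `a/b` with `b ≤ Q` and `a/b ≤ 1/g(Q)`
is `O((Q²/g(Q)²)(log Q)²)`, with an absolute implied constant. -/
theorem dedekind_sum_near_zero_bound :
    ∃ C : ℝ, 0 < C ∧ ∀ g : ℝ → ℝ, Monotone g → (∀ x : ℝ, 0 < g x) →
      Filter.Tendsto g Filter.atTop Filter.atTop →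
      ∀ Q : ℕ, 2 ≤ Q → 1 ≤ g Q →
      |∑ b ∈ Finset.Icc 1 Q,
          ∑ a ∈ (Finset.Icc 1 b).filter
              (fun a : ℕ => Nat.gcd a b = 1 ∧ (a : ℝ) / b ≤ 1 / g Q),
            dedekindSum b a|
      ≤ C * ((Q : ℝ)^2 / (g Q)^2) * (Real.log Q)^2 := by
  refine ⟨9/4, by norm_num, ?_⟩
  intro g _ _ _ Q hQ hG
  set G := g Q with hGdef
  have hG0 : 0 < G := by linarith
  have hsw : (∑ b ∈ Finset.Icc 1 Q,
          ∑ a ∈ (Finset.Icc 1 b).filter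
              (fun a : ℕ => Nat.gcd a b = 1 ∧ (a : ℝ) / b ≤ 1 / G),
            dedekindSum b a) = ∑ a ∈ Finset.Icc 1 ⌊(Q : ℝ) / G⌋₊,
          ∑ b ∈ (Finset.Ico ⌈(a : ℝ) * G⌉₊ (Q + 1)).filter (fun b : ℕ => Nat.gcd a b = 1),
            dedekindSum b a := by
    apply Finset.sum_comm'
    intro b a
    simp only [Finset.mem_Icc, Finset.mem_filter, Finset.mem_Ico, Nat.ceil_le]
    have hfl : a ≤ ⌊(Q : ℝ) / G⌋₊ ↔ (a : ℝ) * G ≤ Q := by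
      rw [Nat.le_floor_iff (by positivity), le_div_iff₀ hG0]
    rw [hfl]
    constructor
    · rintro ⟨⟨hb1, hbQ⟩, ⟨ha1, hab⟩, hg, hle⟩
      have hbR : (0:ℝ) < b := by exact_mod_cast hb1
      have hbQR : (b:ℝ) ≤ Q := by exact_mod_cast hbQ
      rw [div_le_div_iff₀ hbR hG0, one_mul] at hle
      exact ⟨⟨⟨hle, by omega⟩, hg⟩, ha1, hle.trans hbQR⟩
    · rintro ⟨⟨⟨hle, hbQ⟩, hg⟩, ha1, _⟩
      have haR : (0:ℝ) < a := by exact_mod_cast ha1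
      have hab : (a:ℝ) ≤ b := by nlinarith
      have hbR : (0:ℝ) < b := by linarith
      have hab' : a ≤ b := by exact_mod_cast hab
      refine ⟨⟨by omega, by omega⟩, ⟨ha1, hab'⟩, hg, ?_⟩
      rw [div_le_div_iff₀ hbR hG0, one_mul]; exact hle
  rw [hsw]
  have hQR : (2:ℝ) ≤ Q := by exact_mod_cast hQ
  have hlog : 1 + Real.log Q ≤ 3 * Real.log Q := by
    have h1 : Real.log 2 ≤ Real.log Q := Real.log_le_log (by norm_num) hQR
    have h2 := Real.log_two_gt_d9
    linarith
  have hterm : ∀ a ∈ Finset.Icc 1 ⌊(Q : ℝ) / G⌋₊,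
      |∑ b ∈ (Finset.Ico ⌈(a : ℝ) * G⌉₊ (Q + 1)).filter (fun b : ℕ => Nat.gcd a b = 1),
            dedekindSum b a| ≤ (Q / G) / 4 * (3 * Real.log Q)^2 := by
    intro a ha
    rw [Finset.mem_Icc, Nat.le_floor_iff (by positivity)] at ha
    have : NeZero a := ⟨by omega⟩
    have haR : (0:ℝ) < a := by exact_mod_cast ha.1
    have haQ : (a:ℝ) ≤ Q := ha.2.trans (div_le_self (by positivity) hG)
    have hla : 0 ≤ Real.log a := Real.log_natCast_nonneg a
    have hl2 : Real.log a ≤ Real.log Q := Real.log_le_log haR haQ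
    rw [Finset.sum_filter]
    refine (inner_bound a _ _).trans ?_
    gcongr
    · exact ha.2
    · linarith
  refine (Finset.abs_sum_le_sum_abs _ _).trans ((Finset.sum_le_card_nsmul _ _ _ hterm).trans ?_)
  rw [Nat.card_Icc, Nat.add_sub_cancel, nsmul_eq_mul]
  have hf : ((⌊(Q : ℝ) / G⌋₊ : ℕ) : ℝ) ≤ Q / G := Nat.floor_le (by positivity)
  calc _ ≤ (Q / G) * ((Q / G) / 4 * (3 * Real.log Q)^2) := by gcongr
    _ = _ := by field_simp; ring
end

section
/- There exists an absolute constant C > 0 such that for all integers Q ≥ 3, | (1/#F(Q)) · Σ_{a/b ∈ S(Q)} s(a,b) − (1/12) log Q | ≤ C·log log Q, where S(Q) is the set of reduced fractions a/b with integers a ≥ 1, b ≥ 1, gcd(a,b) = 1, b ≤ Q, and a/b ≤ 1/log Q. -/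
/-- The Farey fractions of order `Q`: rationals in `[0,1]` with denominator at most `Q`. -/
def farey (Q : ℕ) : Finset ℚ :=
  (Finset.Icc 1 Q).biUnion fun w => (Finset.Icc 0 w).image fun v : ℕ => (v : ℚ) / (w : ℚ)


/-- sawtooth at `n / k`. -/
noncomputable def vv (k n : ℕ) : ℝ := if n % k = 0 then 0 else ((n % k : ℕ) : ℝ) / k - 1/2

lemma saw_eq_vv (k n : ℕ) (hk : 0 < k) : saw ((n : ℝ) / k) = vv k n := by
  unfold saw vv
  rw [Int.fract_div_natCast_eq_div_natCast_mod]
  have : ((((n % k : ℕ) : ℝ) / k = 0)) ↔ n % k = 0 := by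
    rw [div_eq_zero_iff]
    have : (k : ℝ) ≠ 0 := by positivity
    simp only [this, or_false]
    exact_mod_cast Iff.rfl
  by_cases h : n % k = 0
  · rw [if_pos (this.2 h), if_pos h]
  · rw [if_neg (fun h' => h (this.1 h')), if_neg h]

lemma vv_mod (k n : ℕ) : vv k (n % k) = vv k n := by
  unfold vv; rw [Nat.mod_mod]

lemma vv_congr {k n m : ℕ} (h : n % k = m % k) : vv k n = vv k m := by
  rw [← vv_mod, h, vv_mod]

lemma vv_zero (k : ℕ) : vv k 0 = 0 := by simp [vv]

lemma ded_eq (h k : ℕ) (hk : 0 < k) :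
    dedekindSum (h : ℤ) (k : ℤ) = ∑ n ∈ Finset.range k, vv k n * vv k (n * h) := by
  unfold dedekindSum
  have e : ∀ n ∈ Finset.Icc 1 ((k : ℤ).toNat), saw ((n : ℝ) / ((k : ℤ) : ℝ)) *
      saw ((n : ℝ) * ((h : ℤ) : ℝ) / ((k : ℤ) : ℝ)) = vv k n * vv k (n * h) := by
    intro n _
    rw [← saw_eq_vv k n hk, ← saw_eq_vv k (n*h) hk]
    push_cast; rfl
  rw [Finset.sum_congr rfl e]
  simp only [Int.toNat_natCast]
  have h1 : vv k k = 0 := by simp [vv]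
  have := Finset.sum_range_succ' (fun n => vv k n * vv k (n * h)) k
  have h2 := Finset.sum_range_succ (fun n => vv k n * vv k (n * h)) k
  rw [h1] at h2
  rw [vv_zero] at this
  have h3 := Finset.sum_Ico_add' (fun n => vv k n * vv k (n * h)) 0 k 1
  simp only [zero_add, Finset.Ico_add_one_right_eq_Icc, Nat.Ico_zero_eq_range] at h3
  linarith

lemma ded_mod (h k : ℕ) (hk : 0 < k) :
    dedekindSum ((h % k : ℕ) : ℤ) (k : ℤ) = dedekindSum (h : ℤ) (k : ℤ) := by
  rw [ded_eq _ _ hk, ded_eq _ _ hk]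
  refine Finset.sum_congr rfl fun n _ => ?_
  congr 1
  apply vv_congr
  simp [Nat.mul_mod]

lemma vv_neg (k n m : ℕ) (hk : 0 < k) (h : (n + m) % k = 0) : vv k n = - vv k m := by
  have hn := Nat.mod_lt n hk
  have hm := Nat.mod_lt m hk
  rw [Nat.add_mod] at h
  have h3 : n % k + m % k = 0 ∨ n % k + m % k = k := by
    rcases Nat.dvd_of_mod_eq_zero h with ⟨c, hc⟩
    have : c < 2 := by
      by_contra hcon
      push Not at hcon
      have : k * 2 ≤ k * c := Nat.mul_le_mul_left _ hcon
      omega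
    interval_cases c <;> omega
  unfold vv
  rcases h3 with h3 | h3
  · have a : n % k = 0 := by omega
    have b : m % k = 0 := by omega
    simp [a, b]
  · have a : n % k ≠ 0 := by omega
    have b : m % k ≠ 0 := by omega
    rw [if_neg a, if_neg b]
    have : ((n % k : ℕ) : ℝ) + ((m % k : ℕ) : ℝ) = k := by exact_mod_cast h3
    have hk' : (k : ℝ) ≠ 0 := by positivity
    field_simp
    linarith

lemma ded_neg (h h' k : ℕ) (hk : 0 < k) (hh : (h + h') % k = 0) :
    dedekindSum (h : ℤ) (k : ℤ) = - dedekindSum (h' : ℤ) (k : ℤ) := by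
  rw [ded_eq _ _ hk, ded_eq _ _ hk, ← Finset.sum_neg_distrib]
  refine Finset.sum_congr rfl fun n _ => ?_
  rw [vv_neg k (n * h) (n * h') hk]
  · ring
  · rw [← mul_add, Nat.mul_mod, hh]; simp

lemma sum_perm (k h : ℕ) (hk : 0 < k) (hc : Nat.Coprime h k) (F : ℕ → ℝ) :
    ∑ n ∈ Finset.range k, F (n * h % k) = ∑ n ∈ Finset.range k, F n := by
  have hinj : Set.InjOn (fun n => n * h % k) (Finset.range k : Set ℕ) := by
    intro x hx y hy hxy
    simp only [Finset.coe_range, Set.mem_Iio] at hx hy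
    have : x * h ≡ y * h [MOD k] := hxy
    have h2 := Nat.ModEq.cancel_right_of_coprime (by simpa [Nat.coprime_comm] using hc) this
    exact Nat.ModEq.eq_of_lt_of_lt h2 hx hy
  have himg : (Finset.range k).image (fun n => n * h % k) = Finset.range k := by
    apply Finset.eq_of_subset_of_card_le
    · intro x hx
      simp only [Finset.mem_image, Finset.mem_range] at hx ⊢
      obtain ⟨n, _, rfl⟩ := hx
      exact Nat.mod_lt _ hk
    · rw [Finset.card_image_of_injOn hinj]
  conv_rhs => rw [← himg]
  rw [Finset.sum_image hinj]

lemma sum1 (k : ℕ) : ∑ n ∈ Finset.range k, (n : ℝ) = k * (k - 1) / 2 := by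
  induction k with
  | zero => simp
  | succ k ih => rw [Finset.sum_range_succ, ih]; push_cast; ring

lemma sum2 (k : ℕ) : ∑ n ∈ Finset.range k, (n : ℝ)^2 = (k - 1) * k * (2 * k - 1) / 6 := by
  induction k with
  | zero => simp
  | succ k ih => rw [Finset.sum_range_succ, ih]; push_cast; ring

lemma ded_formula (h k : ℕ) (hk : 0 < k) (hc : Nat.Coprime h k) :
    dedekindSum (h : ℤ) (k : ℤ) =
      (∑ n ∈ Finset.range k, (n : ℝ) * ((n * h % k : ℕ) : ℝ)) / k^2 - (k - 1) / 4 := by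
  rw [ded_eq _ _ hk]
  have e : ∀ n ∈ Finset.range k, vv k n * vv k (n * h) =
      ((n : ℝ) * ((n * h % k : ℕ) : ℝ)) / k^2 - (n : ℝ) / (2 * k) - ((n * h % k : ℕ) : ℝ) / (2 * k)
       + 1/4 - if n = 0 then 1/4 else 0 := by
    intro n hn
    have hn' := Finset.mem_range.1 hn
    by_cases h0 : n = 0
    · subst h0; simp [vv]
    · have a : n % k = n := Nat.mod_eq_of_lt hn'
      have b : n * h % k ≠ 0 := by
        intro hb
        have := Nat.Coprime.dvd_of_dvd_mul_right hc.symm (Nat.dvd_of_mod_eq_zero hb)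
        exact h0 (Nat.eq_zero_of_dvd_of_lt this hn')
      unfold vv
      rw [a, if_neg h0, if_neg b, if_neg h0]
      have hk' : (k : ℝ) ≠ 0 := by positivity
      field_simp
      ring
  rw [Finset.sum_congr rfl e]
  simp only [Finset.sum_sub_distrib, Finset.sum_add_distrib, ← Finset.sum_div]
  rw [sum_perm k h hk hc (fun n => (n : ℝ)), sum1]
  simp only [Finset.sum_ite_eq', Finset.mem_range, hk, if_true, Finset.sum_const, Finset.card_range, nsmul_eq_mul]
  have hk' : (k : ℝ) ≠ 0 := by positivity
  field_simp
  ring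

lemma two_sum_le (h q : ℕ) (hq : q < h) :
    ∑ m ∈ (Finset.range h).filter (fun m => m ≤ q), (m : ℝ) = q * (q + 1) / 2 := by
  have : (Finset.range h).filter (fun m => m ≤ q) = Finset.range (q + 1) := by
    ext m; simp; omega
  rw [this, sum1]; push_cast; ring

lemma recip_aux (h k : ℕ) (hh : 0 < h) (hk : 0 < k) (hc : Nat.Coprime h k) :
    ∑ n ∈ Finset.range k, ((n * h / k : ℕ) : ℝ) * (((n * h / k : ℕ) : ℝ) + 1) =
      (k - 1) * (h * (h - 1)) - 2 * ∑ m ∈ Finset.range h, (m : ℝ) * ((m * k / h : ℕ) : ℝ) := by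
  have e1 : ∀ n ∈ Finset.range k, ((n * h / k : ℕ) : ℝ) * (((n * h / k : ℕ) : ℝ) + 1) =
      2 * ∑ m ∈ Finset.range h, if m ≤ n * h / k then (m : ℝ) else 0 := by
    intro n hn
    have hn' := Finset.mem_range.1 hn
    rw [← Finset.sum_filter, two_sum_le]
    · ring
    · rw [Nat.div_lt_iff_lt_mul hk, mul_comm]
      exact Nat.mul_lt_mul_of_pos_left hn' hh
  rw [Finset.sum_congr rfl e1, ← Finset.mul_sum, Finset.sum_comm]
  have e2 : ∀ m ∈ Finset.range h, (∑ n ∈ Finset.range k, if m ≤ n * h / k then (m : ℝ) else 0) =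
      (m : ℝ) * (k - 1) - (m : ℝ) * ((m * k / h : ℕ) : ℝ) := by
    intro m hm
    have hm' := Finset.mem_range.1 hm
    by_cases h0 : m = 0
    · subst h0; simp
    · have : (Finset.range k).filter (fun n => m ≤ n * h / k) = Finset.Ico (m * k / h + 1) k := by
        ext n
        simp only [Finset.mem_filter, Finset.mem_range, Finset.mem_Ico]
        rw [Nat.le_div_iff_mul_le hk, Nat.succ_le_iff, Nat.div_lt_iff_lt_mul hh]
        constructor
        · rintro ⟨a, b⟩
          refine ⟨lt_of_le_of_ne b ?_, a⟩
          intro heq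
          have : h ∣ m * k := ⟨n, by rw [heq]; ring⟩
          have := Nat.Coprime.dvd_of_dvd_mul_right hc this
          exact h0 (Nat.eq_zero_of_dvd_of_lt this hm')
        · rintro ⟨a, b⟩; exact ⟨b, a.le⟩
      rw [← Finset.sum_filter, this, Finset.sum_const, Nat.card_Ico, nsmul_eq_mul, Nat.cast_sub]
      · push_cast; ring
      · rw [Nat.succ_le_iff, Nat.div_lt_iff_lt_mul hh, mul_comm]
        exact Nat.mul_lt_mul_of_pos_left hm' hk
  rw [Finset.sum_congr rfl e2, Finset.sum_sub_distrib, ← Finset.sum_mul, sum1]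
  ring

lemma recip (h k : ℕ) (hh : 0 < h) (hk : 0 < k) (hc : Nat.Coprime h k) :
    dedekindSum (h : ℤ) (k : ℤ) + dedekindSum (k : ℤ) (h : ℤ) =
      -1/4 + ((h : ℝ) / k + (k : ℝ) / h + 1 / (h * k)) / 12 := by
  have hk' : (k : ℝ) ≠ 0 := by positivity
  have hh' : (h : ℝ) ≠ 0 := by positivity
  have md : ∀ (h k n : ℕ), ((n * h % k : ℕ) : ℝ) = n * h - k * ((n * h / k : ℕ) : ℝ) := by
    intro h k n
    have := Nat.mod_add_div (n * h) k
    have : ((n * h % k : ℕ) : ℝ) + k * ((n * h / k : ℕ) : ℝ) = n * h := by exact_mod_cast this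
    linarith
  rw [ded_formula h k hk hc, ded_formula k h hh hc.symm]
  have f : ∀ (h k : ℕ), ∑ n ∈ Finset.range k, (n : ℝ) * ((n * h % k : ℕ) : ℝ) =
      h * ((k - 1) * k * (2 * k - 1) / 6) - k * ∑ n ∈ Finset.range k, (n : ℝ) * ((n * h / k : ℕ) : ℝ) := by
    intro h k
    rw [← sum2, Finset.mul_sum, Finset.mul_sum, ← Finset.sum_sub_distrib]
    refine Finset.sum_congr rfl fun n _ => ?_
    rw [md]; ring
  rw [f h k, f k h]
  have A1 := sum_perm k h hk hc (fun n => (n : ℝ))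
  have A2 := sum_perm k h hk hc (fun n => (n : ℝ)^2)
  have B := recip_aux h k hh hk hc
  rw [sum1] at A1
  rw [sum2] at A2
  simp only [md] at A1 A2
  have A1' : ∑ n ∈ Finset.range k, ((n : ℝ) * h - k * ((n * h / k : ℕ) : ℝ)) =
     h * (k * (k - 1) / 2) - k * ∑ n ∈ Finset.range k, ((n * h / k : ℕ) : ℝ) := by
    rw [← sum1, Finset.mul_sum, Finset.mul_sum, ← Finset.sum_sub_distrib]
    refine Finset.sum_congr rfl fun n _ => ?_
    ring
  have A2' : ∑ n ∈ Finset.range k, ((n : ℝ) * h - k * ((n * h / k : ℕ) : ℝ))^2 =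
     h^2 * ((k - 1) * k * (2 * k - 1) / 6) - 2 * h * k * (∑ n ∈ Finset.range k, (n : ℝ) * ((n * h / k : ℕ) : ℝ))
       + k^2 * ∑ n ∈ Finset.range k, ((n * h / k : ℕ) : ℝ)^2 := by
    rw [← sum2, Finset.mul_sum, Finset.mul_sum, Finset.mul_sum, ← Finset.sum_sub_distrib, ← Finset.sum_add_distrib]
    refine Finset.sum_congr rfl fun n _ => ?_
    ring
  have B' : ∑ n ∈ Finset.range k, ((n * h / k : ℕ) : ℝ) * (((n * h / k : ℕ) : ℝ) + 1) =
     ∑ n ∈ Finset.range k, ((n * h / k : ℕ) : ℝ)^2 + ∑ n ∈ Finset.range k, ((n * h / k : ℕ) : ℝ) := by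
    rw [← Finset.sum_add_distrib]
    refine Finset.sum_congr rfl fun n _ => ?_
    ring
  rw [A1'] at A1
  rw [A2'] at A2
  rw [B'] at B
  set X := ∑ n ∈ Finset.range k, (n : ℝ) * ((n * h / k : ℕ) : ℝ)
  set Y := ∑ n ∈ Finset.range k, ((n * h / k : ℕ) : ℝ)^2
  set Z := ∑ n ∈ Finset.range k, ((n * h / k : ℕ) : ℝ)
  set X' := ∑ n ∈ Finset.range h, (n : ℝ) * ((n * k / h : ℕ) : ℝ)
  have hZ : Z = (h - 1) * (k - 1) / 2 := by
    have : k * Z = k * ((h - 1) * (k - 1) / 2) := by linarith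
    exact mul_left_cancel₀ hk' this
  have hX' : X' = ((k - 1) * (h * (h - 1)) - Y - Z) / 2 := by linarith
  have hX : X = ((h^2 - 1) * ((k - 1) * k * (2 * k - 1) / 6) + k^2 * Y) / (2 * h * k) := by
    rw [eq_div_iff (by positivity)]
    linarith
  rw [hX', hX, hZ]
  field_simp
  ring

lemma recip_bound (h k : ℕ) (hh : 0 < h) (hk : 0 < k) (hc : Nat.Coprime h k) (hle : h ≤ k) :
    |dedekindSum (h : ℤ) (k : ℤ) + dedekindSum (k : ℤ) (h : ℤ) - (k : ℝ) / h / 12| ≤ 1 := by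
  rw [recip h k hh hk hc]
  have h1 : (1 : ℝ) ≤ h := by exact_mod_cast hh
  have h2 : (1 : ℝ) ≤ k := by exact_mod_cast hk
  have a : (h : ℝ) / k ≤ 1 := by
    rw [div_le_one (by positivity)]; exact_mod_cast hle
  have a' : 0 ≤ (h : ℝ) / k := by positivity
  have b : 1 / ((h : ℝ) * k) ≤ 1 := by
    rw [div_le_one (by positivity)]; nlinarith
  have b' : 0 ≤ 1 / ((h : ℝ) * k) := by positivity
  rw [abs_le]; constructor <;> linarith

lemma geom_id (z : ℂ) (m : ℕ) : (z - 1) * ∑ n ∈ Finset.range m, (n : ℂ) * z ^ n =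
    m * z ^ m - z * ∑ n ∈ Finset.range m, z ^ n := by
  induction m with
  | zero => simp
  | succ m ih => rw [Finset.sum_range_succ, Finset.sum_range_succ, mul_add, ih]; push_cast; ring

lemma four_coef (k : ℕ) (hk : 0 < k) (z : ℂ) (hz : z ^ k = 1) (hz1 : z ≠ 1) :
    ∑ n ∈ Finset.range k, z ^ n * (vv k n : ℂ) = 1 / (z - 1) + 1 / 2 := by
  have hz' : z - 1 ≠ 0 := sub_ne_zero.2 hz1
  have hk' : (k : ℂ) ≠ 0 := by exact_mod_cast hk.ne'
  have g0 : ∑ n ∈ Finset.range k, z ^ n = 0 := by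
    have := mul_geom_sum z k
    rw [hz, sub_self] at this
    exact (mul_eq_zero.1 this).resolve_left hz'
  have g1 := geom_id z k
  rw [g0, hz] at g1
  have e : ∀ n ∈ Finset.range k, z ^ n * (vv k n : ℂ) =
      (n : ℂ) * z ^ n / k - z ^ n / 2 + if n = 0 then 1/2 else 0 := by
    intro n hn
    have hn' := Finset.mem_range.1 hn
    unfold vv
    rw [Nat.mod_eq_of_lt hn']
    by_cases h0 : n = 0
    · subst h0; simp
    · rw [if_neg h0, if_neg h0]; push_cast; ring
  rw [Finset.sum_congr rfl e, Finset.sum_add_distrib, Finset.sum_sub_distrib, ← Finset.sum_div,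
    ← Finset.sum_div, g0]
  simp only [Finset.sum_ite_eq', Finset.mem_range, hk, if_true]
  have : ∑ n ∈ Finset.range k, (n : ℂ) * z ^ n = k / (z - 1) := by
    rw [eq_div_iff hz', mul_comm, g1]; ring
  rw [this]
  field_simp
  ring

/-- majorant of the Fourier coefficients -/
noncomputable def ww (k j : ℕ) : ℝ := if j = 0 then 0 else (k : ℝ) / 2 * (1 / (j : ℝ) + 1 / ((k : ℝ) - j))

lemma ww_nonneg (k j : ℕ) (h : j < k) : 0 ≤ ww k j := by
  unfold ww
  split_ifs
  · rfl
  · have : (0:ℝ) < (k : ℝ) - j := by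
      rw [sub_pos]; exact_mod_cast h
    positivity

lemma norm_lower (k j : ℕ) (h0 : 0 < j) (h : j < k) :
    2 / ‖Complex.exp (2 * Real.pi * Complex.I * j / k) - 1‖ ≤ ww k j := by
  have hk : (0:ℝ) < k := by exact_mod_cast (h0.trans h)
  have hj : (0:ℝ) < j := by exact_mod_cast h0
  have hkj : (0:ℝ) < (k : ℝ) - j := by
      rw [sub_pos]; exact_mod_cast h
  have e : (2 * Real.pi * Complex.I * j / k : ℂ) = Complex.I * ((2 * (Real.pi * j / k) : ℝ) : ℂ) := by
    push_cast; ring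
  rw [e, Complex.norm_exp_I_mul_ofReal_sub_one]
  have e2 : 2 * (Real.pi * j / k) / 2 = Real.pi * j / k := by ring
  rw [e2]
  unfold ww
  rw [if_neg h0.ne']
  have key : ∀ x : ℝ, 0 < x → x ≤ k / 2 → 2 * x / k ≤ Real.sin (Real.pi * x / k) := by
    intro x hx hx2
    have := Real.mul_le_sin (x := Real.pi * x / k) (by positivity) (by
      rw [div_le_iff₀ hk]; nlinarith [Real.pi_pos])
    refine le_trans (le_of_eq ?_) this
    have := Real.pi_pos.ne'
    field_simp
  have fin : ∀ x : ℝ, 0 < x → 2 * x / k ≤ Real.sin (Real.pi * j / k) →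
      2 / ‖2 * Real.sin (Real.pi * j / k)‖ ≤ (k : ℝ) / 2 * (1 / x) := by
    intro x hx hs
    have h1 : (0:ℝ) < 2 * x / k := by positivity
    have h2 : 0 < Real.sin (Real.pi * j / k) := lt_of_lt_of_le h1 hs
    rw [Real.norm_eq_abs, abs_of_pos (by positivity)]
    calc 2 / (2 * Real.sin (Real.pi * j / k)) ≤ 2 / (2 * (2 * x / k)) := by gcongr
      _ = (k : ℝ) / 2 * (1 / x) := by field_simp
  have p1 : 0 < (k : ℝ) / 2 * (1 / j) := by positivity
  have p2 : 0 < (k : ℝ) / 2 * (1 / (k - j)) := by positivity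
  rw [mul_add]
  rcases le_total (j : ℝ) (k / 2) with hc | hc
  · have := fin j hj (key j hj hc)
    linarith
  · have h3 := key (k - j) hkj (by linarith)
    have h4 : Real.sin (Real.pi * (k - j) / k) = Real.sin (Real.pi * j / k) := by
      rw [← Real.sin_pi_sub]; congr 1; field_simp; ring
    rw [h4] at h3
    have := fin _ hkj h3
    linarith

lemma sum_ww (k : ℕ) (hk : 0 < k) : ∑ j ∈ Finset.range k, ww k j ≤ k * (1 + Real.log k) := by
  obtain ⟨m, rfl⟩ : ∃ m, k = m + 1 := ⟨k - 1, by omega⟩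
  rw [Finset.sum_range_succ']
  have h0 : ww (m+1) 0 = 0 := by simp [ww]
  rw [h0, add_zero]
  have e : ∀ j ∈ Finset.range m, ww (m+1) (j+1) =
     ((m + 1 : ℕ) : ℝ) / 2 * (1 / ((j + 1 : ℕ) : ℝ)) + ((m + 1 : ℕ) : ℝ) / 2 * (1 / ((m - 1 - j + 1 : ℕ) : ℝ)) := by
    intro j hj
    have := Finset.mem_range.1 hj
    unfold ww
    rw [if_neg (by omega), mul_add]
    congr 3
    rw [← Nat.cast_sub (by omega)]
    congr 1
    omega
  rw [Finset.sum_congr rfl e, Finset.sum_add_distrib,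
    Finset.sum_range_reflect (fun j => ((m + 1 : ℕ) : ℝ) / 2 * (1 / ((j + 1 : ℕ) : ℝ))) m, ← Finset.mul_sum]
  have hh : ∑ i ∈ Finset.range m, 1 / ((i + 1 : ℕ) : ℝ) = (harmonic m : ℝ) := by
    unfold harmonic; push_cast; simp
  rw [hh]
  have h1 := harmonic_le_one_add_log m
  have h2 : Real.log m ≤ Real.log ((m + 1 : ℕ) : ℝ) := by
    rcases Nat.eq_zero_or_pos m with rfl | hm
    · simp
    · apply Real.log_le_log
      · exact_mod_cast hm
      · push_cast; linarith
  have : ((m + 1 : ℕ) : ℝ) * (harmonic m : ℝ) ≤ ((m + 1 : ℕ) : ℝ) * (1 + Real.log ((m + 1 : ℕ) : ℝ)) := by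
    apply mul_le_mul_of_nonneg_left _ (by positivity)
    linarith
  linarith

lemma sum_periodic (F : ℕ → ℝ) (k g : ℕ) (hF : ∀ n, F (n + k) = F n) :
    ∑ n ∈ Finset.range (g * k), F n = g * ∑ n ∈ Finset.range k, F n := by
  have hF' : ∀ g n, F (g * k + n) = F n := by
    intro g
    induction g with
    | zero => simp
    | succ g ih => intro n; rw [← ih n, ← hF (g * k + n)]; congr 1; ring
  induction g with
  | zero => simp
  | succ g ih =>
    rw [Nat.succ_mul, Finset.sum_range_add, ih]
    simp only [hF']; push_cast; ring

lemma sum_ww_mul (k r : ℕ) (hk : 0 < k) :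
    ∑ h ∈ Finset.range k, ww k (r * h % k) ≤ k * (1 + Real.log k) := by
  set g := Nat.gcd r k with hg
  have hgpos : 0 < g := Nat.gcd_pos_of_pos_right _ hk
  obtain ⟨r', hr'⟩ : g ∣ r := Nat.gcd_dvd_left _ _
  obtain ⟨k', hk'⟩ : g ∣ k := Nat.gcd_dvd_right _ _
  have hk'pos : 0 < k' := by
    rcases Nat.eq_zero_or_pos k' with h | h
    · rw [h] at hk'; omega
    · exact h
  have hcop : Nat.Coprime r' k' := by
    have : Nat.gcd r k = g * Nat.gcd r' k' := by
      conv_lhs => rw [hr', hk']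
      rw [Nat.gcd_mul_left]
    rw [← hg] at this
    exact Nat.eq_of_mul_eq_mul_left hgpos (by omega)
  have e : ∀ h ∈ Finset.range k, ww k (r * h % k) = ww k' (h * r' % k') := by
    intro h _
    have h1 : r * h % k = g * (h * r' % k') := by
      rw [← Nat.mul_mod_mul_left, ← hk']; congr 1; conv_lhs => rw [hr']
      ring
    rw [h1]
    have hgr : (g : ℝ) ≠ 0 := by exact_mod_cast hgpos.ne'
    have hkr : (k : ℝ) = g * k' := by exact_mod_cast hk'
    unfold ww
    by_cases h0 : h * r' % k' = 0
    · simp [h0]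
    · have hlt := Nat.mod_lt (h * r') hk'pos
      rw [if_neg (by simp [h0, hgpos.ne']), if_neg h0, hkr]
      set t := h * r' % k'
      have ht : (t : ℝ) ≠ 0 := by exact_mod_cast h0
      have htt : (k' : ℝ) - t ≠ 0 := by
        have : (t : ℝ) < k' := by exact_mod_cast hlt
        linarith
      push_cast
      rw [← mul_sub]
      field_simp
  rw [Finset.sum_congr rfl e]
  conv_lhs => rw [hk']
  rw [sum_periodic (fun h => ww k' (h * r' % k')) k' g (by intro n; simp [add_mul]),
    sum_perm k' r' hk'pos hcop (ww k')]
  have h1 := sum_ww k' hk'pos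
  have hkr : (k : ℝ) = g * k' := by exact_mod_cast hk'
  have h2 : Real.log k' ≤ Real.log k := by
    apply Real.log_le_log
    · exact_mod_cast hk'pos
    · exact_mod_cast (by rw [hk']; exact Nat.le_mul_of_pos_left _ hgpos)
  calc (g : ℝ) * ∑ n ∈ Finset.range k', ww k' n ≤ g * (k' * (1 + Real.log k')) := by gcongr
    _ = k * (1 + Real.log k') := by rw [hkr]; ring
    _ ≤ _ := by gcongr

open ZMod in
lemma sum_zmod {E : Type*} [AddCommMonoid E] (k : ℕ) [NeZero k] (F : ZMod k → E) :
    ∑ x : ZMod k, F x = ∑ n ∈ Finset.range k, F (n : ZMod k) := by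
  symm
  refine Finset.sum_bij (fun n _ => (n : ZMod k)) (fun _ _ => Finset.mem_univ _) ?_ ?_ ?_
  · intro a ha b hb hab
    have := congrArg ZMod.val hab
    rwa [ZMod.val_natCast, ZMod.val_natCast, Nat.mod_eq_of_lt (Finset.mem_range.1 ha),
      Nat.mod_eq_of_lt (Finset.mem_range.1 hb)] at this
  · intro b _
    exact ⟨b.val, Finset.mem_range.2 (ZMod.val_lt b), ZMod.natCast_zmod_val b⟩
  · intros; rfl

/-- Sawtooth on `ZMod k`. -/
noncomputable def ff (k : ℕ) (x : ZMod k) : ℂ := (vv k x.val : ℂ)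

lemma ff_nat (k : ℕ) (n : ℕ) : ff k (n : ZMod k) = (vv k n : ℂ) := by
  unfold ff; rw [ZMod.val_natCast, vv_mod]

lemma ff_neg (k : ℕ) [NeZero k] (x : ZMod k) : ff k (-x) = - ff k x := by
  unfold ff
  rw [vv_neg k (-x).val x.val (Nat.pos_of_ne_zero (NeZero.ne k))]
  · simp
  · rw [← ZMod.val_add]; simp

open ZMod in
lemma dft_bound (k : ℕ) [NeZero k] (x : ZMod k) : ‖dft (ff k) (-x)‖ ≤ ww k x.val := by
  have hk : 0 < k := Nat.pos_of_ne_zero (NeZero.ne k)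
  rw [dft_apply]
  by_cases hx : x = 0
  · subst hx
    simp only [neg_zero, mul_zero, AddChar.map_zero_eq_one, one_smul, ZMod.val_zero]
    have : ∑ x, ff k x = 0 := by
      have h1 : ∑ x, ff k x = ∑ x, ff k (-x) := (Equiv.sum_comp (Equiv.neg (ZMod k)) (ff k)).symm
      simp only [ff_neg, Finset.sum_neg_distrib] at h1
      exact self_eq_neg.1 h1
    rw [this]; simp [ww]
  · set z : ℂ := stdAddChar x with hzdef
    have hxv : x.val ≠ 0 := by simpa using hx
    have hz1 : z ≠ 1 := by
      intro h
      apply hx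
      apply injective_stdAddChar
      rw [← hzdef, h, AddChar.map_zero_eq_one]
    have hzk : z ^ k = 1 := by
      rw [hzdef, ← AddChar.map_nsmul_eq_pow]; simp
    have hsum : ∑ j : ZMod k, stdAddChar (-(j * -x)) • ff k j = 1 / (z - 1) + 1 / 2 := by
      rw [sum_zmod, ← four_coef k hk z hzk hz1]
      refine Finset.sum_congr rfl fun n _ => ?_
      rw [ff_nat, smul_eq_mul]
      congr 1
      rw [hzdef, ← AddChar.map_nsmul_eq_pow]; congr 1; simp
    rw [hsum]
    have hzexp : z = Complex.exp (2 * Real.pi * Complex.I * x.val / k) := by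
      have := stdAddChar_coe (N := k) (x.val : ℤ)
      simp only [Int.cast_natCast, ZMod.natCast_zmod_val] at this
      rw [hzdef, this]
    refine le_trans ?_ (norm_lower k x.val (Nat.pos_of_ne_zero hxv) (ZMod.val_lt x))
    rw [← hzexp]
    have hpos : 0 < ‖z - 1‖ := norm_pos_iff.2 (sub_ne_zero.2 hz1)
    have hzn : ‖z‖ = 1 := Complex.norm_eq_one_of_pow_eq_one hzk hk.ne'
    have hle : ‖z - 1‖ ≤ 2 := by
      calc ‖z - 1‖ ≤ ‖z‖ + ‖(1:ℂ)‖ := norm_sub_le _ _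
        _ = 2 := by rw [hzn]; norm_num
    calc ‖1 / (z - 1) + 1 / 2‖ ≤ ‖1 / (z - 1)‖ + ‖(1 / 2 : ℂ)‖ := norm_add_le _ _
      _ = 1 / ‖z - 1‖ + 1 / 2 := by rw [norm_div]; norm_num
      _ ≤ 1 / ‖z - 1‖ + 1 / ‖z - 1‖ := by gcongr
      _ = _ := by ring

open ZMod in
lemma ded_dft (k h : ℕ) [NeZero k] :
    ((dedekindSum (h : ℤ) (k : ℤ) : ℝ) : ℂ) =
      (k : ℂ)⁻¹ * ∑ r : ZMod k, dft (ff k) r * dft (ff k) (-(r * h)) := by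
  have hk : 0 < k := Nat.pos_of_ne_zero (NeZero.ne k)
  have e1 : ((dedekindSum (h : ℤ) (k : ℤ) : ℝ) : ℂ) = ∑ x : ZMod k, ff k x * ff k (x * h) := by
    rw [ded_eq _ _ hk, sum_zmod]
    push_cast
    refine Finset.sum_congr rfl fun n _ => ?_
    rw [ff_nat, ← ff_nat k (n * h)]; push_cast; rfl
  have inv : ∀ y, ff k y = (k : ℂ)⁻¹ * ∑ j : ZMod k, stdAddChar (j * y) * dft (ff k) j := by
    intro y
    have := invDFT_apply (dft (ff k)) y
    rw [LinearEquiv.symm_apply_apply] at this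
    simpa [smul_eq_mul] using this
  have e2 : ∀ x : ZMod k, ff k x * ff k (x * h) = (k : ℂ)⁻¹ * ∑ j : ZMod k,
      dft (ff k) j * (stdAddChar (-(x * -(j * (h : ZMod k)))) * ff k x) := by
    intro x
    conv_lhs => rw [inv (x * h)]
    rw [mul_left_comm, Finset.mul_sum]
    congr 1
    refine Finset.sum_congr rfl fun j _ => ?_
    have : j * (x * (h : ZMod k)) = -(x * -(j * (h : ZMod k))) := by ring
    rw [this]
    ring
  rw [e1, Finset.sum_congr rfl (fun x _ => e2 x), ← Finset.mul_sum, Finset.sum_comm]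
  congr 1
  refine Finset.sum_congr rfl fun j _ => ?_
  rw [← Finset.mul_sum, dft_apply (ff k) (-(j * (h : ZMod k)))]
  simp only [smul_eq_mul]

open ZMod in
lemma ded_L1 (k : ℕ) (hk : 0 < k) :
    ∑ h ∈ Finset.range k, |dedekindSum (h : ℤ) (k : ℤ)| ≤ k * (1 + Real.log k) ^ 2 := by
  have : NeZero k := ⟨hk.ne'⟩
  have hkr : (0:ℝ) < k := by exact_mod_cast hk
  have hlog : 0 ≤ Real.log k := Real.log_natCast_nonneg k
  have e : ∀ h ∈ Finset.range k, |dedekindSum (h : ℤ) (k : ℤ)| ≤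
      (k : ℝ)⁻¹ * ∑ r : ZMod k, ww k (-r).val * ww k (r.val * h % k) := by
    intro h hh
    rw [← Real.norm_eq_abs, ← Complex.norm_real, ded_dft, norm_mul, norm_inv, Complex.norm_natCast]
    gcongr
    refine (norm_sum_le _ _).trans (Finset.sum_le_sum fun r _ => ?_)
    rw [norm_mul]
    have h1 := dft_bound k (-r)
    rw [neg_neg] at h1
    have h2 := dft_bound k (r * h)
    rw [ZMod.val_mul, ZMod.val_natCast, Nat.mod_eq_of_lt (Finset.mem_range.1 hh)] at h2
    exact mul_le_mul h1 h2 (norm_nonneg _) (ww_nonneg _ _ (ZMod.val_lt _))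
  refine (Finset.sum_le_sum e).trans ?_
  rw [← Finset.mul_sum, Finset.sum_comm]
  have e2 : ∑ r : ZMod k, ∑ h ∈ Finset.range k, ww k (-r).val * ww k (r.val * h % k) ≤
      ∑ r : ZMod k, ww k (-r).val * (k * (1 + Real.log k)) := by
    refine Finset.sum_le_sum fun r _ => ?_
    rw [← Finset.mul_sum]
    exact mul_le_mul_of_nonneg_left (sum_ww_mul k r.val hk) (ww_nonneg _ _ (ZMod.val_lt _))
  have e3 : ∑ r : ZMod k, ww k (-r).val ≤ k * (1 + Real.log k) := by
    have := Equiv.sum_comp (Equiv.neg (ZMod k)) (fun r => ww k r.val)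
    simp only [Equiv.neg_apply] at this
    rw [this, sum_zmod]
    refine le_trans (le_of_eq ?_) (sum_ww k hk)
    refine Finset.sum_congr rfl fun n hn => ?_
    rw [ZMod.val_natCast, Nat.mod_eq_of_lt (Finset.mem_range.1 hn)]
  rw [← Finset.sum_mul] at e2
  calc _ ≤ (k : ℝ)⁻¹ * ((k * (1 + Real.log k)) * (k * (1 + Real.log k))) := by
        gcongr
        refine e2.trans ?_
        gcongr
    _ = _ := by field_simp

/-- Dedekind sum restricted to coprime arguments. -/
noncomputable def gg (a b : ℕ) : ℝ := if Nat.gcd a b = 1 then dedekindSum (b : ℤ) (a : ℤ) else 0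

lemma gg_mod (a b : ℕ) (ha : 0 < a) : gg a (b % a) = gg a b := by
  have h : Nat.gcd a (b % a) = Nat.gcd a b := by rw [Nat.gcd_comm a (b % a), ← Nat.gcd_rec]
  unfold gg; simp only [ded_mod _ _ ha, h]

lemma gg_sum (a : ℕ) (ha : 0 < a) : ∑ b ∈ Finset.range a, gg a b = 0 := by
  have this : ∀ b ∈ Finset.range a, gg a (a - 1 - b) = - gg a (b + 1) := by
    intro b hb
    have hb' := Finset.mem_range.1 hb
    have hadd : (a - 1 - b) + (b + 1) = a := by omega
    have hg : Nat.gcd a (a - 1 - b) = Nat.gcd a (b + 1) := by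
      have : a - 1 - b = a - (b + 1) := by omega
      rw [this, Nat.gcd_self_sub_right (by omega)]
    unfold gg
    simp only [hg, ded_neg (a - 1 - b) (b + 1) a ha (by rw [hadd]; simp)]
    split_ifs <;> simp
  have h1 := Finset.sum_range_reflect (gg a) a
  rw [Finset.sum_congr rfl this, Finset.sum_neg_distrib] at h1
  have s1 := Finset.sum_range_succ' (gg a) a
  have s2 := Finset.sum_range_succ (gg a) a
  have : gg a a = gg a 0 := by rw [← gg_mod a a ha]; simp
  linarith

lemma gg_range (a n : ℕ) (ha : 0 < a) :
    |∑ b ∈ Finset.range n, gg a b| ≤ a * (1 + Real.log a) ^ 2 := by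
  have hper : ∀ n, gg a (n + a) = gg a n := by
    intro n; rw [← gg_mod a (n + a) ha, ← gg_mod a n ha]; simp
  have hn : n = (n / a) * a + n % a := by rw [mul_comm]; exact (Nat.div_add_mod n a).symm
  rw [hn, Finset.sum_range_add, sum_periodic _ _ _ hper, gg_sum a ha, mul_zero, zero_add]
  have e : ∀ b, gg a ((n / a) * a + b) = gg a b := by
    intro b; rw [← gg_mod a _ ha, ← gg_mod a b ha]; simp [Nat.add_mod]
  simp only [e]
  refine (Finset.abs_sum_le_sum_abs _ _).trans ?_
  refine le_trans ?_ (ded_L1 a ha)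
  calc _ ≤ ∑ b ∈ Finset.range a, |gg a b| :=
        Finset.sum_le_sum_of_subset_of_nonneg
          (Finset.range_subset_range.2 (Nat.mod_lt n ha).le) (fun _ _ _ => abs_nonneg _)
    _ ≤ _ := by
        refine Finset.sum_le_sum fun b _ => ?_
        unfold gg
        split_ifs
        · rfl
        · simp

lemma gg_Ico (a m n : ℕ) (ha : 0 < a) (hmn : m ≤ n) :
    |∑ b ∈ Finset.Ico m n, gg a b| ≤ 2 * (a * (1 + Real.log a) ^ 2) := by
  rw [Finset.sum_Ico_eq_sub _ hmn]
  have h1 := gg_range a m ha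
  have h2 := gg_range a n ha
  have := abs_sub (∑ b ∈ Finset.range n, gg a b) (∑ b ∈ Finset.range m, gg a b)
  linarith

open ArithmeticFunction in
lemma mob_sum (n : ℕ) :
    ∑ d ∈ n.divisors, ((moebius d : ℤ) : ℝ) = if n = 1 then 1 else 0 := by
  have h := congrArg (fun f : ArithmeticFunction ℤ => f n) coe_zeta_mul_moebius
  simp only [coe_zeta_mul_apply, one_apply] at h
  have := congrArg (fun x : ℤ => (x : ℝ)) h
  push_cast at this
  simpa using this

open ArithmeticFunction in
lemma mob_id (G : ℝ → ℝ) (b : ℕ) (hb : 0 < b) :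
    ∑ a ∈ (Finset.Icc 1 b).filter (fun a => Nat.gcd a b = 1), G ((a : ℝ) / b) =
      ∑ d ∈ b.divisors, ((moebius d : ℤ) : ℝ) *
        ∑ a ∈ Finset.Icc 1 (b / d), G ((a : ℝ) / ((b / d : ℕ) : ℝ)) := by
  rw [Finset.sum_filter]
  have e1 : ∀ a ∈ Finset.Icc 1 b, (if Nat.gcd a b = 1 then G ((a : ℝ) / b) else 0) =
      ∑ d ∈ b.divisors, if d ∣ a then ((moebius d : ℤ) : ℝ) * G ((a : ℝ) / b) else 0 := by
    intro a ha
    have ha' := (Finset.mem_Icc.1 ha).1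
    rw [← Finset.sum_filter, ← Finset.sum_mul]
    have : b.divisors.filter (fun d => d ∣ a) = (Nat.gcd a b).divisors := by
      ext d
      simp only [Finset.mem_filter, Nat.mem_divisors, Nat.dvd_gcd_iff]
      have : Nat.gcd a b ≠ 0 := (Nat.gcd_pos_of_pos_right _ hb).ne'
      have hb' := hb.ne'
      tauto
    rw [this, mob_sum]
    split_ifs <;> simp
  rw [Finset.sum_congr rfl e1, Finset.sum_comm]
  refine Finset.sum_congr rfl fun d hd => ?_
  have hdb : d ∣ b := Nat.dvd_of_mem_divisors hd
  have hd0 : 0 < d := Nat.pos_of_mem_divisors hd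
  rw [← Finset.sum_filter, ← Finset.mul_sum]
  congr 1
  symm
  refine Finset.sum_bij (fun a _ => d * a) ?_ ?_ ?_ ?_
  · intro a ha
    simp only [Finset.mem_filter, Finset.mem_Icc] at ha ⊢
    refine ⟨⟨Nat.mul_pos hd0 ha.1, ?_⟩, dvd_mul_right _ _⟩
    calc d * a ≤ d * (b / d) := Nat.mul_le_mul_left _ ha.2
      _ ≤ b := Nat.mul_div_le _ _
  · intro x _ y _ hxy
    exact Nat.eq_of_mul_eq_mul_left hd0 hxy
  · intro a ha
    simp only [Finset.mem_filter, Finset.mem_Icc] at ha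
    obtain ⟨⟨h1, h2⟩, c, rfl⟩ := ha
    refine ⟨c, ?_, rfl⟩
    rw [Finset.mem_Icc, Nat.le_div_iff_mul_le hd0]
    refine ⟨Nat.pos_of_mul_pos_left h1, by rwa [mul_comm]⟩
  · intro a _
    congr 1
    obtain ⟨c, rfl⟩ := hdb
    rw [Nat.mul_div_cancel_left _ hd0]
    have : (d : ℝ) ≠ 0 := by exact_mod_cast hd0.ne'
    push_cast
    rw [mul_div_mul_left _ _ this]

open ArithmeticFunction in
lemma mob_bound (G : ℝ → ℝ) (b : ℕ) (hb : 0 < b) :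
    |∑ a ∈ (Finset.Icc 1 b).filter (fun a => Nat.gcd a b = 1), G ((a : ℝ) / b)| ≤
      ∑ e ∈ b.divisors, |∑ a ∈ Finset.Icc 1 e, G ((a : ℝ) / (e : ℝ))| := by
  rw [mob_id G b hb, ← Nat.sum_div_divisors b (fun e => |∑ a ∈ Finset.Icc 1 e, G ((a : ℝ) / (e : ℝ))|)]
  refine (Finset.abs_sum_le_sum_abs _ _).trans (Finset.sum_le_sum fun d _ => ?_)
  rw [abs_mul]
  have : |((moebius d : ℤ) : ℝ)| ≤ 1 := by exact_mod_cast abs_moebius_le_one (n := d)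
  exact mul_le_of_le_one_left (abs_nonneg _) this

lemma sum_divisors_swap (Q : ℕ) (f : ℕ → ℝ) :
    ∑ b ∈ Finset.Icc 1 Q, ∑ e ∈ b.divisors, f e = ∑ e ∈ Finset.Icc 1 Q, ((Q / e : ℕ) : ℝ) * f e := by
  have : ∀ e ∈ Finset.Icc 1 Q, ((Q / e : ℕ) : ℝ) * f e =
      ∑ b ∈ (Finset.Icc 1 Q).filter (fun b => e ∣ b), f e := by
    intro e _
    rw [Finset.sum_const, nsmul_eq_mul]
    congr 2
    exact (Nat.Ioc_filter_dvd_card_eq_div Q e).symm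
  rw [Finset.sum_congr rfl this]
  apply Finset.sum_comm'
  intro b e
  simp only [Finset.mem_Icc, Nat.mem_divisors, Finset.mem_filter]
  constructor
  · rintro ⟨⟨h1, h2⟩, h3, h4⟩
    exact ⟨⟨⟨h1, h2⟩, h3⟩, Nat.pos_of_dvd_of_pos h3 h1, (Nat.le_of_dvd h1 h3).trans h2⟩
  · rintro ⟨⟨⟨h1, h2⟩, h3⟩, h4, h5⟩
    exact ⟨⟨h1, h2⟩, h3, by omega⟩

lemma prod_Icc_fact (Q : ℕ) : ∏ i ∈ Finset.Icc 1 Q, (i : ℝ) = (Q.factorial : ℝ) := by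
  induction Q with
  | zero => simp
  | succ n ih =>
    rw [Finset.prod_Icc_succ_top (by omega), ih, Nat.factorial_succ]
    push_cast
    ring

lemma sum_log (Q : ℕ) (hQ : 0 < Q) : ∑ e ∈ Finset.Icc 1 Q, Real.log ((Q : ℝ) / e) ≤ Q := by
  have h := Real.pow_div_factorial_le_exp (x := (Q : ℝ)) (by positivity) Q
  have hq : (0:ℝ) < Q := by exact_mod_cast hQ
  have e : ∑ e ∈ Finset.Icc 1 Q, Real.log ((Q : ℝ) / e) = Real.log ((Q : ℝ) ^ Q / (Q.factorial : ℝ)) := by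
    rw [← Real.log_prod]
    · congr 1
      rw [Finset.prod_div_distrib, Finset.prod_const, Nat.card_Icc, Nat.add_sub_cancel,
        prod_Icc_fact]
    · intro x hx
      have : (0:ℝ) < x := by exact_mod_cast (Finset.mem_Icc.1 hx).1
      positivity
  rw [e]
  rw [Real.log_le_iff_le_exp (by positivity)]
  exact h

/-- The test function. -/
noncomputable def GG (L t : ℝ) : ℝ := (if t ≤ 1 / L then 1 / t else 0) - L

lemma GG_bound (Q e : ℕ) (he : 1 ≤ e) (heQ : e ≤ Q) (hL : 1 ≤ Real.log Q) :
    |∑ a ∈ Finset.Icc 1 e, GG (Real.log Q) ((a : ℝ) / (e : ℝ))| ≤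
      e * (1 + Real.log (Real.log Q) + Real.log ((Q : ℝ) / e)) := by
  set L := Real.log Q with hLdef
  have hL0 : 0 < L := by linarith
  have he0 : (0:ℝ) < e := by exact_mod_cast he
  have hQ0 : (0:ℝ) < Q := by exact_mod_cast (lt_of_lt_of_le he heQ)
  have hfil : (Finset.Icc 1 e).filter (fun a : ℕ => (a : ℝ) / e ≤ 1 / L) = Finset.Icc 1 ⌊(e : ℝ) / L⌋₊ := by
    ext a
    simp only [Finset.mem_filter, Finset.mem_Icc]
    rw [Nat.le_floor_iff (by positivity), div_le_div_iff₀ he0 hL0, le_div_iff₀ hL0, one_mul]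
    constructor
    · rintro ⟨⟨h1, _⟩, h2⟩; exact ⟨h1, h2⟩
    · rintro ⟨h1, h2⟩
      refine ⟨⟨h1, ?_⟩, h2⟩
      have : (a : ℝ) ≤ a * L := le_mul_of_one_le_right (by positivity) hL
      exact_mod_cast this.trans h2
  have hsum : ∑ a ∈ Finset.Icc 1 e, GG L ((a : ℝ) / (e : ℝ)) =
      e * ((harmonic ⌊(e : ℝ) / L⌋₊ : ℚ) : ℝ) - e * L := by
    unfold GG
    rw [Finset.sum_sub_distrib, ← Finset.sum_filter, hfil, harmonic_eq_sum_Icc, Finset.sum_const,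
      Nat.card_Icc, Nat.add_sub_cancel, nsmul_eq_mul]
    push_cast
    rw [Finset.mul_sum]
    congr 1
    refine Finset.sum_congr rfl fun a _ => ?_
    rw [one_div_div]; rfl
  rw [hsum, ← mul_sub, abs_mul, abs_of_pos he0]
  apply mul_le_mul_of_nonneg_left _ he0.le
  have hlogL : 0 ≤ Real.log L := Real.log_nonneg hL
  have hQe : Real.log ((Q : ℝ) / e) = L - Real.log e := by
    rw [Real.log_div hQ0.ne' he0.ne']
  have hQe0 : 0 ≤ Real.log ((Q : ℝ) / e) := by
    apply Real.log_nonneg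
    rw [le_div_iff₀ he0, one_mul]; exact_mod_cast heQ
  rw [abs_le]
  constructor
  · have := log_le_harmonic_floor ((e : ℝ) / L) (by positivity)
    rw [Real.log_div he0.ne' hL0.ne'] at this
    linarith
  · rcases le_or_gt 1 ((e : ℝ) / L) with h | h
    · have := harmonic_floor_le_one_add_log _ h
      rw [Real.log_div he0.ne' hL0.ne'] at this
      linarith
    · rw [Nat.floor_eq_zero.2 h]
      simp only [harmonic_zero, Rat.cast_zero]
      linarith

lemma main_term (Q : ℕ) (hQ : 0 < Q) (hL : 1 ≤ Real.log Q) :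
    |∑ b ∈ Finset.Icc 1 Q, ∑ a ∈ (Finset.Icc 1 b).filter (fun a => Nat.gcd a b = 1),
      GG (Real.log Q) ((a : ℝ) / b)| ≤ (Q : ℝ)^2 * (2 + Real.log (Real.log Q)) := by
  have hlogL : 0 ≤ Real.log (Real.log Q) := Real.log_nonneg hL
  refine (Finset.abs_sum_le_sum_abs _ _).trans ?_
  refine (Finset.sum_le_sum fun b hb => mob_bound _ b (Finset.mem_Icc.1 hb).1).trans ?_
  rw [sum_divisors_swap Q (fun e => |∑ a ∈ Finset.Icc 1 e, GG (Real.log Q) ((a : ℝ) / (e : ℝ))|)]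
  have e1 : ∀ e ∈ Finset.Icc 1 Q, ((Q / e : ℕ) : ℝ) *
      |∑ a ∈ Finset.Icc 1 e, GG (Real.log Q) ((a : ℝ) / (e : ℝ))| ≤
      Q * (1 + Real.log (Real.log Q)) + Q * Real.log ((Q : ℝ) / e) := by
    intro e he
    obtain ⟨h1, h2⟩ := Finset.mem_Icc.1 he
    have he0 : (0:ℝ) < e := by exact_mod_cast h1
    have hQe0 : 0 ≤ Real.log ((Q : ℝ) / e) := by
      apply Real.log_nonneg
      rw [le_div_iff₀ he0, one_mul]; exact_mod_cast h2
    calc _ ≤ ((Q : ℝ) / e) * (e * (1 + Real.log (Real.log Q) + Real.log ((Q : ℝ) / e))) :=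
          mul_le_mul Nat.cast_div_le (GG_bound Q e h1 h2 hL) (abs_nonneg _) (by positivity)
      _ = _ := by field_simp
  refine (Finset.sum_le_sum e1).trans ?_
  rw [Finset.sum_add_distrib, Finset.sum_const, Nat.card_Icc, Nat.add_sub_cancel, nsmul_eq_mul,
    ← Finset.mul_sum]
  have := mul_le_mul_of_nonneg_left (sum_log Q hQ) (Nat.cast_nonneg (α := ℝ) Q)
  nlinarith

lemma rem_term (Q : ℕ) (hQ : 0 < Q) (hL : 1 ≤ Real.log Q) :
    |∑ b ∈ Finset.Icc 1 Q, ∑ a ∈ (Finset.Icc 1 b).filter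
      (fun a : ℕ => Nat.gcd a b = 1 ∧ (a : ℝ) / b ≤ 1 / Real.log Q),
      dedekindSum (b : ℤ) (a : ℤ)| ≤ 8 * (Q : ℝ)^2 := by
  set L := Real.log Q with hLdef
  have hL0 : 0 < L := by linarith
  have hQ0 : (0:ℝ) < Q := by exact_mod_cast hQ
  have e1 : ∀ b ∈ Finset.Icc 1 Q, ∑ a ∈ (Finset.Icc 1 b).filter
      (fun a : ℕ => Nat.gcd a b = 1 ∧ (a : ℝ) / b ≤ 1 / L), dedekindSum (b : ℤ) (a : ℤ) =
      ∑ a ∈ (Finset.Icc 1 b).filter (fun a : ℕ => (a : ℝ) / b ≤ 1 / L), gg a b := by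
    intro b _
    unfold gg
    rw [← Finset.sum_filter, Finset.filter_filter]
    refine Finset.sum_congr ?_ (fun _ _ => rfl)
    ext a; simp only [Finset.mem_filter]; tauto
  have e2 : ∑ b ∈ Finset.Icc 1 Q, ∑ a ∈ (Finset.Icc 1 b).filter (fun a : ℕ => (a : ℝ) / b ≤ 1 / L), gg a b
     = ∑ a ∈ Finset.Icc 1 ⌊(Q : ℝ) / L⌋₊, ∑ b ∈ Finset.Ico ⌈(a : ℝ) * L⌉₊ (Q + 1), gg a b := by
    apply Finset.sum_comm'
    intro b a
    simp only [Finset.mem_filter, Finset.mem_Icc, Finset.mem_Ico]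
    rw [Nat.le_floor_iff (by positivity), le_div_iff₀ (b := (Q : ℝ)) hL0, Nat.ceil_le, Nat.lt_succ_iff]
    constructor
    · rintro ⟨⟨h1, h2⟩, ⟨h3, h4⟩, h5⟩
      have hb0 : (0:ℝ) < b := by exact_mod_cast h1
      rw [div_le_div_iff₀ hb0 hL0, one_mul] at h5
      have : (b : ℝ) ≤ Q := by exact_mod_cast h2
      exact ⟨⟨h5, h2⟩, h3, h5.trans this⟩
    · rintro ⟨⟨h1, h2⟩, h3, h4⟩
      have ha0 : (0:ℝ) < a := by exact_mod_cast h3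
      have hab : (a : ℝ) ≤ b := (le_mul_of_one_le_right (by positivity) hL).trans h1
      have hb0 : (0:ℝ) < b := by linarith
      rw [div_le_div_iff₀ hb0 hL0, one_mul]
      have hab' : a ≤ b := by exact_mod_cast hab
      exact ⟨⟨by omega, h2⟩, ⟨h3, hab'⟩, h1⟩
  rw [Finset.sum_congr rfl e1, e2]
  refine (Finset.abs_sum_le_sum_abs _ _).trans ?_
  have e3 : ∀ a ∈ Finset.Icc 1 ⌊(Q : ℝ) / L⌋₊,
      |∑ b ∈ Finset.Ico ⌈(a : ℝ) * L⌉₊ (Q + 1), gg a b| ≤ 8 * Q * L := by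
    intro a ha
    obtain ⟨h1, h2⟩ := Finset.mem_Icc.1 ha
    rw [Nat.le_floor_iff (by positivity), le_div_iff₀ hL0] at h2
    have ha0 : (0:ℝ) < a := by exact_mod_cast h1
    have haQ : (a : ℝ) ≤ Q := (le_mul_of_one_le_right (by positivity) hL).trans h2
    have hlog : Real.log a ≤ L := Real.log_le_log ha0 haQ
    have hlog0 : 0 ≤ Real.log a := Real.log_natCast_nonneg a
    refine (gg_Ico a _ _ h1 ?_).trans ?_
    · rw [Nat.ceil_le]; push_cast; linarith
    · calc 2 * ((a : ℝ) * (1 + Real.log a)^2) ≤ 2 * (a * (2 * L)^2) := by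
            gcongr; linarith
        _ = 8 * (a * L) * L := by ring
        _ ≤ 8 * Q * L := by gcongr
  refine (Finset.sum_le_sum e3).trans ?_
  rw [Finset.sum_const, Nat.card_Icc, Nat.add_sub_cancel, nsmul_eq_mul]
  calc (⌊(Q : ℝ) / L⌋₊ : ℝ) * (8 * Q * L) ≤ (Q : ℝ) / L * (8 * Q * L) := by
        gcongr; exact Nat.floor_le (by positivity)
    _ = _ := by field_simp

/-- number of reduced residues -/
def cc (b : ℕ) : ℕ := ((Finset.Icc 1 b).filter (fun a => Nat.gcd a b = 1)).card

lemma sum_inv_sq (Q : ℕ) (hQ : 2 ≤ Q) : ∑ d ∈ Finset.Icc 2 Q, 1 / (d : ℝ)^2 ≤ (3/4 : ℝ) - 1 / (Q : ℝ) := by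
  induction Q, hQ using Nat.le_induction with
  | base => norm_num
  | succ n hn ih =>
    rw [Finset.sum_Icc_succ_top (by omega)]
    have h0 : (0:ℝ) < n := by exact_mod_cast (by omega : 0 < n)
    have : 1 / ((n + 1 : ℕ) : ℝ)^2 ≤ 1 / (n : ℝ) - 1 / ((n + 1 : ℕ) : ℝ) := by
      push_cast
      rw [div_sub_div _ _ (by positivity) (by positivity), div_le_div_iff₀ (by positivity) (by positivity)]
      nlinarith
    linarith

lemma cc_lower (Q : ℕ) (hQ : 2 ≤ Q) : (Q : ℝ)^2 / 8 ≤ ∑ b ∈ Finset.Icc 1 Q, (cc b : ℝ) := by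
  have hQ0 : (0:ℝ) < Q := by exact_mod_cast (by omega : 0 < Q)
  have card : ∀ d : ℕ, ∑ a ∈ Finset.Icc 1 Q, (if d ∣ a then (1:ℝ) else 0) = ((Q / d : ℕ) : ℝ) := by
    intro d
    rw [← Finset.sum_filter, Finset.sum_const, nsmul_eq_mul, mul_one]
    congr 1
    exact (Nat.Ioc_filter_dvd_card_eq_div Q d)
  have h1 : ∀ a ∈ Finset.Icc 1 Q, ∀ b ∈ Finset.Icc 1 Q, (1:ℝ) ≤
      (if a ≤ b ∧ Nat.gcd a b = 1 then 1 else 0) + (if b ≤ a ∧ Nat.gcd b a = 1 then 1 else 0) +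
      ∑ d ∈ Finset.Icc 2 Q, (if d ∣ a then (1:ℝ) else 0) * (if d ∣ b then (1:ℝ) else 0) := by
    intro a ha b hb
    obtain ⟨ha1, ha2⟩ := Finset.mem_Icc.1 ha
    have hs : ∀ d ∈ Finset.Icc 2 Q, (0:ℝ) ≤ (if d ∣ a then (1:ℝ) else 0) * (if d ∣ b then (1:ℝ) else 0) := by
      intro d _
      split_ifs <;> simp
    have p1 : (0:ℝ) ≤ if a ≤ b ∧ Nat.gcd a b = 1 then 1 else 0 := by split_ifs <;> simp
    have p2 : (0:ℝ) ≤ if b ≤ a ∧ Nat.gcd b a = 1 then 1 else 0 := by split_ifs <;> simp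
    by_cases hg : Nat.gcd a b = 1
    · have p3 := Finset.sum_nonneg hs
      rcases le_total a b with h | h
      · rw [if_pos ⟨h, hg⟩]; linarith
      · rw [if_pos (⟨h, by rwa [Nat.gcd_comm]⟩ : b ≤ a ∧ Nat.gcd b a = 1)]; linarith
    · have hpos : 0 < Nat.gcd a b := Nat.gcd_pos_of_pos_left _ ha1
      have hle : Nat.gcd a b ≤ a := Nat.gcd_le_left _ ha1
      have := Finset.single_le_sum hs (Finset.mem_Icc.2 ⟨(by omega : 2 ≤ Nat.gcd a b), hle.trans ha2⟩)
      rw [if_pos (Nat.gcd_dvd_left a b), if_pos (Nat.gcd_dvd_right a b)] at this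
      linarith
  have h2 := Finset.sum_le_sum fun a ha => Finset.sum_le_sum (h1 a ha)
  simp only [Finset.sum_add_distrib] at h2
  have hcc : ∀ b ∈ Finset.Icc 1 Q, ∑ a ∈ Finset.Icc 1 Q, (if a ≤ b ∧ Nat.gcd a b = 1 then (1:ℝ) else 0) = cc b := by
    intro b hb
    rw [← Finset.sum_filter, Finset.sum_const, nsmul_eq_mul, mul_one]
    unfold cc
    congr 2
    ext a
    simp only [Finset.mem_filter, Finset.mem_Icc] at hb ⊢
    constructor
    · rintro ⟨⟨_, _⟩, _, _⟩; exact ⟨⟨by assumption, by assumption⟩, by assumption⟩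
    · rintro ⟨⟨h1, h2⟩, h3⟩; exact ⟨⟨h1, by omega⟩, h2, h3⟩
  have t1 : ∑ a ∈ Finset.Icc 1 Q, ∑ b ∈ Finset.Icc 1 Q, (if a ≤ b ∧ Nat.gcd a b = 1 then (1:ℝ) else 0) =
      ∑ b ∈ Finset.Icc 1 Q, (cc b : ℝ) := by
    rw [Finset.sum_comm]; exact Finset.sum_congr rfl hcc
  have t2 : ∑ a ∈ Finset.Icc 1 Q, ∑ b ∈ Finset.Icc 1 Q, (if b ≤ a ∧ Nat.gcd b a = 1 then (1:ℝ) else 0) =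
      ∑ b ∈ Finset.Icc 1 Q, (cc b : ℝ) := Finset.sum_congr rfl hcc
  have t3 : ∑ a ∈ Finset.Icc 1 Q, ∑ b ∈ Finset.Icc 1 Q, ∑ d ∈ Finset.Icc 2 Q,
      (if d ∣ a then (1:ℝ) else 0) * (if d ∣ b then (1:ℝ) else 0) ≤ 3/4 * (Q:ℝ)^2 := by
    have : ∀ a ∈ Finset.Icc 1 Q, ∑ b ∈ Finset.Icc 1 Q, ∑ d ∈ Finset.Icc 2 Q,
      (if d ∣ a then (1:ℝ) else 0) * (if d ∣ b then (1:ℝ) else 0) =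
      ∑ d ∈ Finset.Icc 2 Q, (if d ∣ a then (1:ℝ) else 0) * ((Q / d : ℕ) : ℝ) := by
      intro a _
      rw [Finset.sum_comm]
      refine Finset.sum_congr rfl fun d _ => ?_
      rw [← Finset.mul_sum, card]
    rw [Finset.sum_congr rfl this, Finset.sum_comm]
    have : ∀ d ∈ Finset.Icc 2 Q, ∑ a ∈ Finset.Icc 1 Q, (if d ∣ a then (1:ℝ) else 0) * ((Q / d : ℕ) : ℝ) ≤
        (Q:ℝ)^2 * (1 / (d:ℝ)^2) := by
      intro d _
      rw [← Finset.sum_mul, card]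
      have hd : ((Q / d : ℕ) : ℝ) ≤ (Q : ℝ) / d := Nat.cast_div_le
      calc ((Q / d : ℕ) : ℝ) * ((Q / d : ℕ) : ℝ) ≤ (Q : ℝ) / d * ((Q : ℝ) / d) := by gcongr
        _ = _ := by ring
    refine (Finset.sum_le_sum this).trans ?_
    rw [← Finset.mul_sum]
    have h3 := sum_inv_sq Q hQ
    have h4 : 0 < 1 / (Q:ℝ) := by positivity
    have := mul_le_mul_of_nonneg_left (h3.trans (by linarith : _ ≤ (3/4:ℝ))) (by positivity : 0 ≤ (Q:ℝ)^2)
    linarith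
  rw [t1, t2] at h2
  simp only [Finset.sum_const, Nat.card_Icc, Nat.add_sub_cancel, nsmul_eq_mul, mul_one] at h2
  nlinarith

lemma farey_card (Q : ℕ) (hQ : 0 < Q) : (farey Q).card = 1 + ∑ b ∈ Finset.Icc 1 Q, cc b := by
  have hset : farey Q = insert 0 (((Finset.Icc 1 Q).sigma
      (fun b => (Finset.Icc 1 b).filter (fun a => Nat.gcd a b = 1))).image
      (fun p : (_ : ℕ) × ℕ => (p.2 : ℚ) / (p.1 : ℚ))) := by
    ext x
    simp only [farey, Finset.mem_biUnion, Finset.mem_image, Finset.mem_insert, Finset.mem_sigma,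
      Finset.mem_filter, Finset.mem_Icc, Sigma.exists]
    constructor
    · rintro ⟨w, ⟨hw1, hw2⟩, v, ⟨_, hv⟩, rfl⟩
      rcases Nat.eq_zero_or_pos v with rfl | hv0
      · left; simp
      · right
        have hg : 0 < Nat.gcd v w := Nat.gcd_pos_of_pos_left _ hv0
        refine ⟨w / Nat.gcd v w, v / Nat.gcd v w, ⟨⟨?_, (Nat.div_le_self _ _).trans hw2⟩, ⟨?_, ?_⟩, ?_⟩, ?_⟩
        · exact Nat.div_pos (Nat.gcd_le_right _ hw1) hg
        · exact Nat.div_pos (Nat.gcd_le_left _ hv0) hg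
        · exact Nat.div_le_div_right hv
        · exact Nat.coprime_div_gcd_div_gcd hg
        · rw [Nat.cast_div (Nat.gcd_dvd_left _ _) (by exact_mod_cast hg.ne'),
            Nat.cast_div (Nat.gcd_dvd_right _ _) (by exact_mod_cast hg.ne')]
          have : ((Nat.gcd v w : ℕ) : ℚ) ≠ 0 := by exact_mod_cast hg.ne'
          have : (w : ℚ) ≠ 0 := by exact_mod_cast (by omega : w ≠ 0)
          field_simp
    · rintro (rfl | ⟨b, a, ⟨⟨h1, h2⟩, ⟨h3, h4⟩, h5⟩, rfl⟩)
      · exact ⟨1, ⟨le_rfl, hQ⟩, 0, by simp, by simp⟩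
      · exact ⟨b, ⟨h1, h2⟩, a, ⟨by omega, h4⟩, rfl⟩
  rw [hset, Finset.card_insert_of_notMem, Finset.card_image_of_injOn, Finset.card_sigma, add_comm]
  · rfl
  · rintro ⟨b, a⟩ h ⟨b', a'⟩ h' heq
    simp only [Finset.coe_sigma, Set.mem_sigma_iff, Finset.mem_coe, Finset.mem_filter, Finset.mem_Icc] at h h'
    have hb : (b : ℚ) ≠ 0 := by exact_mod_cast (by omega : b ≠ 0)
    have hb' : (b' : ℚ) ≠ 0 := by exact_mod_cast (by omega : b' ≠ 0)
    simp only at heq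
    rw [div_eq_div_iff hb hb'] at heq
    have heq' : a * b' = a' * b := by exact_mod_cast heq
    have c1 : Nat.Coprime a b := h.2.2
    have c2 : Nat.Coprime a' b' := h'.2.2
    have d1 : b ∣ b' := c1.symm.dvd_of_dvd_mul_left ⟨a', by rw [heq']; ring⟩
    have d2 : b' ∣ b := c2.symm.dvd_of_dvd_mul_left ⟨a, by rw [← heq']; ring⟩
    have hbb : b = b' := Nat.dvd_antisymm d1 d2
    subst hbb
    have haa : a = a' := Nat.eq_of_mul_eq_mul_right (by omega) heq'
    subst haa
    rfl
  · simp only [Finset.mem_image, Finset.mem_sigma, Finset.mem_filter, Finset.mem_Icc, Sigma.exists, not_exists]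
    rintro b a ⟨⟨⟨h1, h2⟩, ⟨h3, h4⟩, h5⟩, h6⟩
    have hb : (0:ℚ) < b := by exact_mod_cast h1
    have ha : (0:ℚ) < a := by exact_mod_cast h3
    have : (0:ℚ) < (a : ℚ) / b := by positivity
    linarith

lemma log3 : 1 < Real.log 3 := by
  rw [Real.lt_log_iff_exp_lt (by norm_num)]
  have := Real.exp_one_lt_d9
  linarith

theorem total_bound (Q : ℕ) (hQ : 3 ≤ Q) :
    |(∑ b ∈ Finset.Icc 1 Q,
            ∑ a ∈ (Finset.Icc 1 b).filter
                (fun a : ℕ => Nat.gcd a b = 1 ∧ (a : ℝ) / b ≤ 1 / Real.log Q),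
              dedekindSum a b) - ((farey Q).card : ℝ) * Real.log Q / 12| ≤
      (Q : ℝ)^2 * (10 + Real.log (Real.log Q)) := by
  have hQ3 : (3:ℝ) ≤ Q := by exact_mod_cast hQ
  have hL3 : Real.log 3 ≤ Real.log Q := Real.log_le_log (by norm_num) hQ3
  have hL : 1 ≤ Real.log Q := by linarith [log3]
  have hLQ : Real.log Q ≤ Q := (Real.log_le_sub_one_of_pos (by linarith)).trans (by linarith)
  have m := main_term Q (by omega) hL
  have r := rem_term Q (by omega) hL
  have hlogL : 0 ≤ Real.log (Real.log Q) := Real.log_nonneg hL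
  rw [farey_card Q (by omega)]
  set L := Real.log Q
  set S : ℕ → Finset ℕ := fun b => (Finset.Icc 1 b).filter
                (fun a : ℕ => Nat.gcd a b = 1 ∧ (a : ℝ) / b ≤ 1 / L) with hS
  have hmain : ∑ b ∈ Finset.Icc 1 Q, ∑ a ∈ (Finset.Icc 1 b).filter (fun a => Nat.gcd a b = 1),
      GG L ((a : ℝ) / b) = (∑ b ∈ Finset.Icc 1 Q, ∑ a ∈ S b, (b : ℝ) / a) -
        (∑ b ∈ Finset.Icc 1 Q, (cc b : ℝ)) * L := by
    rw [Finset.sum_mul, ← Finset.sum_sub_distrib]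
    refine Finset.sum_congr rfl fun b _ => ?_
    unfold GG
    rw [Finset.sum_sub_distrib, ← Finset.sum_filter, Finset.filter_filter, Finset.sum_const, nsmul_eq_mul]
    simp only [one_div_div]
    rfl
  rw [hmain] at m
  have herr : |(∑ b ∈ Finset.Icc 1 Q, ∑ a ∈ S b, dedekindSum a b) +
      (∑ b ∈ Finset.Icc 1 Q, ∑ a ∈ S b, dedekindSum b a) -
      (∑ b ∈ Finset.Icc 1 Q, ∑ a ∈ S b, (b : ℝ) / a) / 12| ≤ (Q:ℝ)^2 := by
    simp only [Finset.sum_div, ← Finset.sum_add_distrib, ← Finset.sum_sub_distrib]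
    have hb1 : ∀ b ∈ Finset.Icc 1 Q, |∑ a ∈ S b, (dedekindSum a b + dedekindSum b a - (b : ℝ) / a / 12)| ≤ Q := by
      intro b hb
      obtain ⟨h1, h2⟩ := Finset.mem_Icc.1 hb
      refine (Finset.abs_sum_le_sum_abs _ _).trans ?_
      calc _ ≤ ∑ a ∈ S b, (1:ℝ) := by
            refine Finset.sum_le_sum fun a ha => ?_
            simp only [hS, Finset.mem_filter, Finset.mem_Icc] at ha
            exact recip_bound a b ha.1.1 h1 ha.2.1 ha.1.2
        _ = ((S b).card : ℝ) := by simp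
        _ ≤ ((Finset.Icc 1 b).card : ℝ) := by exact_mod_cast Finset.card_filter_le _ _
        _ ≤ Q := by simp only [Nat.card_Icc, Nat.add_sub_cancel]; exact_mod_cast h2
    refine (Finset.abs_sum_le_sum_abs _ _).trans ((Finset.sum_le_sum hb1).trans ?_)
    rw [Finset.sum_const, Nat.card_Icc, Nat.add_sub_cancel, nsmul_eq_mul, sq]
  change |∑ b ∈ Finset.Icc 1 Q, ∑ a ∈ S b, dedekindSum b a| ≤ _ at r
  push_cast
  set A := ∑ b ∈ Finset.Icc 1 Q, ∑ a ∈ S b, dedekindSum a b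
  set R := ∑ b ∈ Finset.Icc 1 Q, ∑ a ∈ S b, dedekindSum b a
  set M := ∑ b ∈ Finset.Icc 1 Q, ∑ a ∈ S b, (b : ℝ) / a
  set N := ∑ b ∈ Finset.Icc 1 Q, (cc b : ℝ)
  rw [abs_le] at *
  obtain ⟨m1, m2⟩ := m
  obtain ⟨r1, r2⟩ := r
  obtain ⟨e1, e2⟩ := herr
  have hq2 : (Q:ℝ) ≤ (Q:ℝ)^2 := by nlinarith
  have hp : 0 ≤ (Q:ℝ)^2 * Real.log L := by positivity
  constructor <;> linarith


/-- **Lemma 5.2.** With `S(Q)` the set of reduced fractions `a/b` with `b ≤ Q` and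
`a/b ≤ 1/log Q`, the average `(1/#F(Q)) ∑_{a/b ∈ S(Q)} s(a,b)` equals
`(1/12) log Q + O(log log Q)`. -/
theorem dedekind_sum_near_zero_average :
    ∃ C : ℝ, 0 < C ∧ ∀ Q : ℕ, 3 ≤ Q →
      |(1 / ((farey Q).card : ℝ)) *
          (∑ b ∈ Finset.Icc 1 Q,
            ∑ a ∈ (Finset.Icc 1 b).filter
                (fun a : ℕ => Nat.gcd a b = 1 ∧ (a : ℝ) / b ≤ 1 / Real.log Q),
              dedekindSum a b)
        - 1/12 * Real.log Q|
      ≤ C * Real.log (Real.log Q) := by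
  have hll : 0 < Real.log (Real.log 3) := Real.log_pos log3
  refine ⟨8 + 80 / Real.log (Real.log 3), by positivity, fun Q hQ => ?_⟩
  have hQ3 : (3:ℝ) ≤ Q := by exact_mod_cast hQ
  have hL3 : Real.log 3 ≤ Real.log Q := Real.log_le_log (by norm_num) hQ3
  have hl := log3
  have hLL : Real.log (Real.log 3) ≤ Real.log (Real.log Q) := Real.log_le_log (by linarith) hL3
  have hN : (Q:ℝ)^2 / 8 ≤ ((farey Q).card : ℝ) := by
    rw [farey_card Q (by omega)]
    have := cc_lower Q (by omega)
    push_cast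
    linarith
  have hT := total_bound Q hQ
  set N := ((farey Q).card : ℝ)
  set A := ∑ b ∈ Finset.Icc 1 Q,
            ∑ a ∈ (Finset.Icc 1 b).filter
                (fun a : ℕ => Nat.gcd a b = 1 ∧ (a : ℝ) / b ≤ 1 / Real.log Q),
              dedekindSum a b
  have hNpos : 0 < N := lt_of_lt_of_le (by positivity) hN
  have e : 1 / N * A - 1 / 12 * Real.log Q = (A - N * Real.log Q / 12) / N := by
    field_simp
  rw [e, abs_div, abs_of_pos hNpos, div_le_iff₀ hNpos]
  have h80 : 80 ≤ 80 / Real.log (Real.log 3) * Real.log (Real.log Q) := by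
    rw [div_mul_eq_mul_div, le_div_iff₀ hll]; linarith
  calc _ ≤ (Q : ℝ)^2 * (10 + Real.log (Real.log Q)) := hT
    _ = (80 + 8 * Real.log (Real.log Q)) * ((Q:ℝ)^2 / 8) := by ring
    _ ≤ (80 + 8 * Real.log (Real.log Q)) * N := by
        apply mul_le_mul_of_nonneg_left hN; linarith
    _ ≤ _ := by
        apply mul_le_mul_of_nonneg_right _ hNpos.le; linarith
end
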